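/- arXiv:1010.5937 — 3 statements merged into one kernel-verified Lean document; each statement's English description precedes it below -/
import Mathlib

section
/- Every directed tree in which every vertex is either a source or a sink (a switch tree) with n vertices admits an upward planar straight-line embedding into every set of n points in convex position. -/
open Finset

noncomputable section

/-- 2D cross product / determinant. -/
def det2 (u v : ℝ × ℝ) : ℝ := u.1 * v.2 - u.2 * v.1

/-- General position: pairwise distinct y-coordinates, no three collinear. -/
def GenPos (S : Finset (ℝ × ℝ)) : Prop :=
  (∀ p ∈ S, ∀ q ∈ S, p ≠ q → p.2 ≠ q.2) ∧
  (∀ p ∈ S, ∀ q ∈ S, ∀ r ∈ S, p ≠ q → p ≠ r → q ≠ r →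
    ¬ Collinear ℝ ({p, q, r} : Set (ℝ × ℝ)))

/-- Convex position: general position and no point in the convex hull of the others. -/
def ConvexPos (S : Finset (ℝ × ℝ)) : Prop :=
  GenPos S ∧ ∀ p ∈ S, p ∉ convexHull ℝ (↑(S.erase p) : Set (ℝ × ℝ))

def IsLowest (S : Finset (ℝ × ℝ)) (b : ℝ × ℝ) : Prop := b ∈ S ∧ ∀ p ∈ S, b.2 ≤ p.2

def IsHighest (S : Finset (ℝ × ℝ)) (t : ℝ × ℝ) : Prop := t ∈ S ∧ ∀ p ∈ S, p.2 ≤ t.2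

/-- One-sided convex point set: all points other than the lowest point `b` and the
highest point `t` lie strictly on one side of the line through `b` and `t`. -/
def OneSided (S : Finset (ℝ × ℝ)) : Prop :=
  ConvexPos S ∧ ∃ b t, IsLowest S b ∧ IsHighest S t ∧
    ((∀ p ∈ S, p ≠ b → p ≠ t → 0 < det2 (t - b) (p - b)) ∨
     (∀ p ∈ S, p ≠ b → p ≠ t → det2 (t - b) (p - b) < 0))

/-- Upward planar straight-line embedding of a digraph (given by its arc relation `Adj`)
into the point set `S` via the vertex placement `f`: vertices go injectively to points of
`S`, every arc goes strictly upward, and two (distinct) arcs may only meet at common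
endpoints. -/
def UPSE {V : Type*} (Adj : V → V → Prop) (S : Finset (ℝ × ℝ)) (f : V → ℝ × ℝ) : Prop :=
  Function.Injective f ∧ (∀ v, f v ∈ S) ∧
  (∀ u v, Adj u v → (f u).2 < (f v).2) ∧
  (∀ a b c d, Adj a b → Adj c d → (a, b) ≠ (c, d) →
    ∀ p, p ∈ segment ℝ (f a) (f b) → p ∈ segment ℝ (f c) (f d) →
      p ∈ ({f a, f b} : Set (ℝ × ℝ)) ∧ p ∈ ({f c, f d} : Set (ℝ × ℝ)))

/-- A directed tree: an orientation (no 2-cycles, no loops) whose underlying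
undirected graph is a tree. -/
def IsDirTree {V : Type*} (Adj : V → V → Prop) : Prop :=
  (∀ u v, Adj u v → ¬ Adj v u) ∧ (∀ v, ¬ Adj v v) ∧
  (SimpleGraph.fromRel Adj).IsTree

/-- Switch digraph: every vertex is a source or a sink. -/
def IsSwitch {V : Type*} (Adj : V → V → Prop) : Prop :=
  ∀ v, (∀ u, ¬ Adj u v) ∨ (∀ u, ¬ Adj v u)

/-! ### Trees built by grafting -/

/-- `GraftTree A r E`: the edges `E` form a tree with vertex set `A` and root `r`, built from
single vertices by hanging a rooted tree below the root of another one. -/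
inductive GraftTree {V : Type*} [DecidableEq V] : Finset V → V → Finset (Sym2 V) → Prop
  | single (r : V) : GraftTree {r} r ∅
  | graft {A B : Finset V} {r u : V} {E F : Finset (Sym2 V)} :
      GraftTree A r E → GraftTree B u F → Disjoint A B →
      GraftTree (A ∪ B) r (insert s(r, u) (E ∪ F))

namespace GraftTree

variable {V : Type*} [DecidableEq V]

lemma root_mem {A : Finset V} {r : V} {E : Finset (Sym2 V)} (h : GraftTree A r E) : r ∈ A := by
  induction h with
  | single r => simp
  | graft h₁ h₂ hd ih₁ ih₂ => exact mem_union_left _ ih₁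

lemma card_pos {A : Finset V} {r : V} {E : Finset (Sym2 V)} (h : GraftTree A r E) :
    0 < A.card :=
  Finset.card_pos.2 ⟨r, h.root_mem⟩

lemma mem_of_mem_edge {A : Finset V} {r : V} {E : Finset (Sym2 V)} (h : GraftTree A r E) :
    ∀ e ∈ E, ∀ x ∈ e, x ∈ A := by
  induction h with
  | single r => simp
  | graft h₁ h₂ hd ih₁ ih₂ =>
    intro e he x hx
    rw [mem_insert, mem_union] at he
    rcases he with rfl | he | he
    · rcases Sym2.mem_iff.1 hx with rfl | rfl
      · exact mem_union_left _ h₁.root_mem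
      · exact mem_union_right _ h₂.root_mem
    · exact mem_union_left _ (ih₁ e he x hx)
    · exact mem_union_right _ (ih₂ e he x hx)

lemma mem_left {A : Finset V} {r : V} {E : Finset (Sym2 V)} (h : GraftTree A r E) {a b : V}
    (he : s(a, b) ∈ E) : a ∈ A :=
  h.mem_of_mem_edge _ he a (by simp)

lemma mem_right {A : Finset V} {r : V} {E : Finset (Sym2 V)} (h : GraftTree A r E) {a b : V}
    (he : s(a, b) ∈ E) : b ∈ A :=
  h.mem_of_mem_edge _ he b (by simp)

lemma insert_leaf {A : Finset V} {r : V} {E : Finset (Sym2 V)} (h : GraftTree A r E) {v x : V}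
    (hv : v ∈ A) (hx : x ∉ A) : GraftTree (insert x A) r (insert s(v, x) E) := by
  induction h with
  | single r =>
    obtain rfl := mem_singleton.1 hv
    have := graft (single v) (single x) (by simp_all [eq_comm])
    convert this using 1
    · ext; simp; tauto
    · simp
  | @graft A B r u E F h₁ h₂ hd ih₁ ih₂ =>
    rw [mem_union, not_or] at hx
    rcases mem_union.1 hv with hv | hv
    · have := graft (ih₁ hv hx.1) h₂ (by rw [disjoint_insert_left]; exact ⟨hx.2, hd⟩)
      convert this using 1
      · ext; simp
      · ext; simp; tauto
    · have := graft h₁ (ih₂ hv hx.2) (by rw [disjoint_insert_right]; exact ⟨hx.1, hd⟩)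
      convert this using 1
      · ext; simp
      · ext; simp; tauto

/-- A nontrivial grafted tree has a single branch at its root, or some branch of size at most
`x` or at most `y`, as soon as its size is at most `x + y + 2`. -/
lemma exists_small_branch {A : Finset V} {r : V} {E : Finset (Sym2 V)} (h : GraftTree A r E)
    {x y : ℕ} (hA : 2 ≤ A.card) (hxy : A.card ≤ x + y + 2) :
    ∃ A₁ E₁ B u F, GraftTree A₁ r E₁ ∧ GraftTree B u F ∧ Disjoint A₁ B ∧ A = A₁ ∪ B ∧
      E = insert s(r, u) (E₁ ∪ F) ∧ (A₁ = {r} ∧ E₁ = ∅ ∨ B.card ≤ x ∨ B.card ≤ y) := by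
  cases h with
  | single r => simp at hA
  | @graft A₁ B _ u E₁ F h₁ h₂ hd =>
    by_cases hs : B.card ≤ x ∨ B.card ≤ y
    · exact ⟨A₁, E₁, B, u, F, h₁, h₂, hd, rfl, rfl, Or.inr hs⟩
    · cases h₁ with
      | single r => exact ⟨{r}, ∅, B, u, F, single r, h₂, hd, rfl, rfl, Or.inl ⟨rfl, rfl⟩⟩
      | @graft A₂ C _ v E₂ F₂ h₃ h₄ hd' =>
        rw [disjoint_union_left] at hd
        refine ⟨A₂ ∪ B, insert s(r, u) (E₂ ∪ F), C, v, F₂, graft h₃ h₂ hd.1, h₄, ?_, ?_, ?_, ?_⟩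
        · rw [disjoint_union_left]
          exact ⟨hd', hd.2.symm⟩
        · ext; simp; tauto
        · ext; simp; tauto
        · have h5 := h₃.card_pos
          rw [card_union_of_disjoint (by rw [disjoint_union_left]; exact hd),
            card_union_of_disjoint hd'] at hxy
          omega

end GraftTree

lemma SimpleGraph.IsTree.graftTree {V : Type*} [Fintype V] [DecidableEq V] {G : SimpleGraph V}
    [DecidableRel G.Adj] (hG : G.IsTree) (r : V) : GraftTree univ r G.edgeFinset := by
  have key : ∀ k, k + 1 ≤ Fintype.card V → ∃ A E, GraftTree A r E ∧ A.card = k + 1 ∧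
      E.card = k ∧ E ⊆ G.edgeFinset := by
    intro k
    induction k with
    | zero => exact fun _ => ⟨{r}, ∅, .single r, by simp, by simp, by simp⟩
    | succ k ih =>
      intro hk
      obtain ⟨A, E, h, hA, hE, hsub⟩ := ih (by omega)
      obtain ⟨x, hx⟩ : ∃ x, x ∉ A := by
        by_contra! hall
        rw [eq_univ_iff_forall.2 hall, card_univ] at hA
        omega
      obtain ⟨p⟩ := hG.connected.preconnected r x
      obtain ⟨d, -, hd₁, hd₂⟩ := p.exists_boundary_dart (A : Set V) h.root_mem hx
      refine ⟨insert d.snd A, insert s(d.fst, d.snd) E, h.insert_leaf hd₁ hd₂, ?_, ?_, ?_⟩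
      · rw [card_insert_of_notMem hd₂, hA]
      · rw [card_insert_of_notMem (fun he => hd₂ (h.mem_right he)), hE]
      · rw [insert_subset_iff]
        exact ⟨by simp [d.adj], hsub⟩
  have hpos : 0 < Fintype.card V := Fintype.card_pos_iff.2 ⟨r⟩
  obtain ⟨A, E, h, hA, hE, hsub⟩ := key (Fintype.card V - 1) (by omega)
  have h₁ : A = univ := eq_univ_of_card A (by omega)
  have h₂ : E = G.edgeFinset := eq_of_subset_of_card_le hsub (by
    have := hG.card_edgeFinset
    omega)
  rwa [h₁, h₂] at h

/-! ### Non-crossing drawings on the line -/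

/-- `f` places the vertices `A` of a rooted tree injectively on the points `P` of the line so
that no two edges interleave and the root lies below no edge. -/
structure Drawing {V : Type*} (E : Finset (Sym2 V)) (A : Finset V) (P : Finset ℝ) (r : V)
    (f : V → ℝ) : Prop where
  injOn : Set.InjOn f A
  mem : ∀ x ∈ A, f x ∈ P
  noncrossing : ∀ a b a' b', s(a, b) ∈ E → s(a', b') ∈ E →
    ¬ (f a < f a' ∧ f a' < f b ∧ f b < f b')
  visible : ∀ a b, s(a, b) ∈ E → ¬ (f a < f r ∧ f r < f b)

/-- Every edge goes from a `false` vertex to a `true` vertex of larger absolute value. -/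
def AbsUpward {V : Type*} (c : V → Bool) (E : Finset (Sym2 V)) (f : V → ℝ) : Prop :=
  ∀ a b, s(a, b) ∈ E → c a = false → c b = true → |f a| < |f b|

lemma Drawing.reflect {V : Type*} {E : Finset (Sym2 V)} {A : Finset V} {P : Finset ℝ} {r : V}
    {f : V → ℝ} {C : ℝ} (h : Drawing E A (P.image (C - ·)) r f) :
    Drawing E A P r (fun x => C - f x) where
  injOn := fun x hx y hy hxy => h.injOn hx hy (sub_right_injective hxy)
  mem := by
    intro x hx
    obtain ⟨p, hp, hpx⟩ := mem_image.1 (h.mem x hx)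
    rwa [← hpx, sub_sub_cancel]
  noncrossing := by
    intro a b a' b' he he' ⟨h₁, h₂, h₃⟩
    refine h.noncrossing b' a' b a (Sym2.eq_swap ▸ he') (Sym2.eq_swap ▸ he) ⟨?_, ?_, ?_⟩ <;>
    linarith
  visible := by
    intro a b he ⟨h₁, h₂⟩
    refine h.visible b a (Sym2.eq_swap ▸ he) ⟨?_, ?_⟩ <;> linarith

lemma Drawing.single {V : Type*} {P : Finset ℝ} {p : ℝ} (hp : p ∈ P) (r : V) :
    Drawing ∅ {r} P r (fun _ => p) where
  injOn := by simp
  mem := by simpa using hp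
  noncrossing := by simp
  visible := by simp

lemma Drawing.graft {V : Type*} [DecidableEq V] {A B : Finset V} {r u : V}
    {E F : Finset (Sym2 V)} {P Q : Finset ℝ} {f g : V → ℝ} {c : V → Bool}
    (hA : GraftTree A r E) (hB : GraftTree B u F) (hAB : Disjoint A B)
    (hf : Drawing E A P r f) (hg : Drawing F B Q u g)
    (hfc : AbsUpward c E f) (hgc : AbsUpward c F g)
    (hr : (∀ q ∈ Q, f r < q) ∨ ∀ q ∈ Q, q < f r)
    (hP : (∀ p ∈ P, p = f r ∨ ∀ q ∈ Q, p < q) ∨ ∀ p ∈ P, p = f r ∨ ∀ q ∈ Q, q < p)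
    (hru : c r = false → c u = true → |f r| < |g u|)
    (hur : c u = false → c r = true → |g u| < |f r|) :
    ∃ k : V → ℝ, k r = f r ∧ Drawing (insert s(r, u) (E ∪ F)) (A ∪ B) (P ∪ Q) r k ∧
      AbsUpward c (insert s(r, u) (E ∪ F)) k := by
  set k : V → ℝ := fun x => if x ∈ B then g x else f x with hk
  have kA : ∀ x ∈ A, k x = f x := fun x hx => if_neg (disjoint_left.1 hAB hx)
  have kB : ∀ x ∈ B, k x = g x := fun x hx => if_pos hx
  have kr : k r = f r := kA r hA.root_mem
  have ku : k u = g u := kB u hB.root_mem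
  have hu : k u ∈ Q := ku ▸ hg.mem u hB.root_mem
  have sep : ∀ p ∈ P, ∀ q ∈ Q, ∀ q' ∈ Q, q < p → p < q' → False := by
    intro p hp q hq q' hq' h₁ h₂
    rcases hP with hP | hP <;> rcases hP p hp with h | h
    · subst h
      rcases hr with hr | hr
      · exact lt_asymm h₁ (hr q hq)
      · exact lt_asymm h₂ (hr q' hq')
    · exact lt_asymm h₁ (h q hq)
    · subst h
      rcases hr with hr | hr
      · exact lt_asymm h₁ (hr q hq)
      · exact lt_asymm h₂ (hr q' hq')
    · exact lt_asymm h₂ (h q' hq')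
  have ne : ∀ p ∈ P, p ∉ Q := by
    intro p hp hq
    rcases hP with hP | hP <;> rcases hP p hp with h | h
    · subst h; rcases hr with hr | hr <;> exact lt_irrefl _ (hr _ hq)
    · exact lt_irrefl _ (h p hq)
    · subst h; rcases hr with hr | hr <;> exact lt_irrefl _ (hr _ hq)
    · exact lt_irrefl _ (h p hq)
  have under : ∀ p ∈ P, ∀ p' ∈ P, p < k u → k u < p' → p = k r ∨ p' = k r := by
    intro p hp p' hp' h₁ h₂
    rw [kr]
    rcases hP with hP | hP
    · exact Or.inr ((hP p' hp').resolve_right fun h => lt_asymm h₂ (h _ hu))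
    · exact Or.inl ((hP p hp).resolve_right fun h => lt_asymm h₁ (h _ hu))
  have memE : ∀ {a b}, s(a, b) ∈ E → k a ∈ P ∧ k b ∈ P := fun he =>
    ⟨kA _ (hA.mem_left he) ▸ hf.mem _ (hA.mem_left he),
      kA _ (hA.mem_right he) ▸ hf.mem _ (hA.mem_right he)⟩
  have memF : ∀ {a b}, s(a, b) ∈ F → k a ∈ Q ∧ k b ∈ Q := fun he =>
    ⟨kB _ (hB.mem_left he) ▸ hg.mem _ (hB.mem_left he),
      kB _ (hB.mem_right he) ▸ hg.mem _ (hB.mem_right he)⟩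
  have visE : ∀ a b, s(a, b) ∈ E → ¬ (k a < k r ∧ k r < k b) := by
    intro a b he
    rw [kA a (hA.mem_left he), kA b (hA.mem_right he), kr]
    exact hf.visible a b he
  have visF : ∀ a b, s(a, b) ∈ F → ¬ (k a < k u ∧ k u < k b) := by
    intro a b he
    rw [kB a (hB.mem_left he), kB b (hB.mem_right he), ku]
    exact hg.visible a b he
  have ncE : ∀ a b a' b', s(a, b) ∈ E → s(a', b') ∈ E →
      ¬ (k a < k a' ∧ k a' < k b ∧ k b < k b') := by
    intro a b a' b' he he'
    rw [kA a (hA.mem_left he), kA b (hA.mem_right he), kA a' (hA.mem_left he'),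
      kA b' (hA.mem_right he')]
    exact hf.noncrossing a b a' b' he he'
  have ncF : ∀ a b a' b', s(a, b) ∈ F → s(a', b') ∈ F →
      ¬ (k a < k a' ∧ k a' < k b ∧ k b < k b') := by
    intro a b a' b' he he'
    rw [kB a (hB.mem_left he), kB b (hB.mem_right he), kB a' (hB.mem_left he'),
      kB b' (hB.mem_right he')]
    exact hg.noncrossing a b a' b' he he'
  have hrP : k r ∈ P := kr ▸ hf.mem r hA.root_mem
  have edge : ∀ {a b}, s(a, b) ∈ insert s(r, u) (E ∪ F) →
      (a = r ∧ b = u) ∨ (a = u ∧ b = r) ∨ s(a, b) ∈ E ∨ s(a, b) ∈ F := by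
    intro a b he
    rw [mem_insert, mem_union, Sym2.eq_iff] at he
    rcases he with (h | h) | h | h
    exacts [Or.inl h, Or.inr (Or.inl h), Or.inr (Or.inr (Or.inl h)), Or.inr (Or.inr (Or.inr h))]
  refine ⟨k, kr, ⟨?_, ?_, ?_, ?_⟩, ?_⟩
  · intro x hx y hy hxy
    rw [mem_coe, mem_union] at hx hy
    rcases hx with hx | hx <;> rcases hy with hy | hy
    · rw [kA x hx, kA y hy] at hxy
      exact hf.injOn hx hy hxy
    · rw [kA x hx, kB y hy] at hxy
      exact absurd (hxy ▸ hg.mem y hy) (ne _ (hf.mem x hx))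
    · rw [kB x hx, kA y hy] at hxy
      exact absurd (hxy ▸ hg.mem x hx) (ne _ (hf.mem y hy))
    · rw [kB x hx, kB y hy] at hxy
      exact hg.injOn hx hy hxy
  · intro x hx
    rcases mem_union.1 hx with hx | hx
    · exact mem_union_left _ (kA x hx ▸ hf.mem x hx)
    · exact mem_union_right _ (kB x hx ▸ hg.mem x hx)
  · rintro a b a' b' he he' ⟨h₁, h₂, h₃⟩
    rcases edge he with ⟨rfl, rfl⟩ | ⟨rfl, rfl⟩ | h | h <;>
    rcases edge he' with ⟨rfl, rfl⟩ | ⟨rfl, rfl⟩ | h' | h'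
    · exact lt_irrefl _ h₁
    · exact lt_irrefl _ h₂
    · rcases under _ (memE h').1 _ (memE h').2 h₂ h₃ with h₀ | h₀ <;> linarith
    · exact visF _ _ h' ⟨h₂, h₃⟩
    · exact lt_irrefl _ h₂
    · exact lt_irrefl _ h₁
    · exact visE _ _ h' ⟨h₂, h₃⟩
    · exact sep _ hrP _ (memF h').1 _ (memF h').2 h₂ h₃
    · exact visE _ _ h ⟨h₁, h₂⟩
    · rcases under _ (memE h).1 _ (memE h).2 h₁ h₂ with h₀ | h₀ <;> linarith
    · exact ncE _ _ _ _ h h' ⟨h₁, h₂, h₃⟩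
    · exact sep _ (memE h).2 _ (memF h').1 _ (memF h').2 h₂ h₃
    · exact sep _ hrP _ (memF h).1 _ (memF h).2 h₁ h₂
    · exact visF _ _ h ⟨h₁, h₂⟩
    · exact sep _ (memE h').1 _ (memF h).1 _ (memF h).2 h₁ h₂
    · exact ncF _ _ _ _ h h' ⟨h₁, h₂, h₃⟩
  · rintro a b he ⟨h₁, h₂⟩
    rcases edge he with ⟨rfl, rfl⟩ | ⟨rfl, rfl⟩ | he | he
    · exact lt_irrefl _ h₁
    · exact lt_irrefl _ h₂
    · exact visE _ _ he ⟨h₁, h₂⟩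
    · exact sep _ hrP _ (memF he).1 _ (memF he).2 h₁ h₂
  · intro a b he ha hb
    rcases edge he with ⟨rfl, rfl⟩ | ⟨rfl, rfl⟩ | he | he
    · rw [kr, ku]; exact hru ha hb
    · rw [kr, ku]; exact hur ha hb
    · rw [kA a (hA.mem_left he), kA b (hA.mem_right he)]
      exact hfc a b he ha hb
    · rw [kB a (hB.mem_left he), kB b (hB.mem_right he)]
      exact hgc a b he ha hb

/-! ### Placing the root of a switch tree at an extreme point -/

lemma Finset.exists_initial_segment {α : Type*} [LinearOrder α] (P : Finset α) {k : ℕ}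
    (hk : k ≤ P.card) : ∃ Q ⊆ P, Q.card = k ∧ ∀ q ∈ Q, ∀ p ∈ P \ Q, q < p := by
  induction k with
  | zero => exact ⟨∅, by simp, by simp, by simp⟩
  | succ k ih =>
    obtain ⟨Q, hQP, hQ, hlt⟩ := ih (by omega)
    have hne : (P \ Q).Nonempty := by
      rw [← Finset.card_pos, card_sdiff_of_subset hQP]
      omega
    have hm := min'_mem _ hne
    refine ⟨insert ((P \ Q).min' hne) Q, ?_, ?_, ?_⟩
    · exact insert_subset (mem_sdiff.1 hm).1 hQP
    · rw [card_insert_of_notMem (mem_sdiff.1 hm).2, hQ]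
    · intro q hq p hp
      rw [mem_sdiff, mem_insert, not_or] at hp
      have hp' : p ∈ P \ Q := mem_sdiff.2 ⟨hp.1, hp.2.2⟩
      rcases mem_insert.1 hq with rfl | hq
      · exact lt_of_le_of_ne (min'_le _ _ hp') (Ne.symm hp.2.1)
      · exact hlt q hq p hp'

lemma Finset.exists_final_segment {α : Type*} [LinearOrder α] (P : Finset α) {k : ℕ}
    (hk : k ≤ P.card) : ∃ Q ⊆ P, Q.card = k ∧ ∀ q ∈ Q, ∀ p ∈ P \ Q, p < q :=
  Finset.exists_initial_segment (α := αᵒᵈ) P hk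

/-- Every switch tree of size `n` whose root is a sink can be drawn upward on every set of `n`
points of the line, with heights given by absolute values and the root at the highest point. -/
def TopDrawable (V : Type*) [DecidableEq V] (n : ℕ) : Prop :=
  ∀ (c : V → Bool) (A : Finset V) (r : V) (E : Finset (Sym2 V)), GraftTree A r E →
    A.card = n → (∀ a b, s(a, b) ∈ E → c a ≠ c b) → c r = true →
    ∀ P : Finset ℝ, P.card = n → Set.InjOn (fun x : ℝ => |x|) P →
      ∃ f, Drawing E A P r f ∧ AbsUpward c E f ∧ ∀ x ∈ P, |x| ≤ |f r|

namespace TopDrawable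

variable {V : Type*} [DecidableEq V]

lemma bottom_of_nonneg {n : ℕ} (h : TopDrawable V n) {c : V → Bool} {A : Finset V} {r : V}
    {E : Finset (Sym2 V)} (hA : GraftTree A r E) (hn : A.card = n)
    (hc : ∀ a b, s(a, b) ∈ E → c a ≠ c b) (hr : c r = false) {P : Finset ℝ} (hPn : P.card = n)
    (hP : ∀ x ∈ P, 0 ≤ x) : ∃ f, Drawing E A P r f ∧ AbsUpward c E f ∧ ∀ x ∈ P, |f r| ≤ |x| := by
  have hub : ∀ x ∈ P, x ≤ ∑ y ∈ P, y := fun x hx => single_le_sum (f := id) hP hx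
  set C := ∑ y ∈ P, y
  have habs : ∀ x ∈ P, |C - x| = C - x := fun x hx => abs_of_nonneg (sub_nonneg.2 (hub x hx))
  have hinj : Set.InjOn (fun x : ℝ => |x|) (P.image (C - ·) : Finset ℝ) := by
    intro x hx y hy hxy
    obtain ⟨x, hx', rfl⟩ := mem_image.1 hx
    obtain ⟨y, hy', rfl⟩ := mem_image.1 hy
    simp only [habs x hx', habs y hy'] at hxy
    exact hxy
  obtain ⟨f, hf, hup, hmax⟩ := h (fun v => !c v) A r E hA hn (by simpa using hc) (by simp [hr])
    (P.image (C - ·)) (by rw [card_image_of_injective _ sub_right_injective, hPn]) hinj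
  have hg := hf.reflect
  have hfabs : ∀ v ∈ A, |C - f v| = C - |f v| := by
    intro v hv
    obtain ⟨x, hx, hxv⟩ := mem_image.1 (hf.mem v hv)
    rw [← hxv, habs x hx, sub_sub_cancel, abs_of_nonneg (hP x hx)]
  refine ⟨_, hg, ?_, ?_⟩
  · intro a b he ha hb
    rw [hfabs a (hA.mem_left he), hfabs b (hA.mem_right he)]
    have := hup b a (Sym2.eq_swap ▸ he) (by simp [hb]) (by simp [ha])
    linarith
  · intro x hx
    have := hmax (C - x) (mem_image_of_mem _ hx)
    rw [hfabs r hA.root_mem, abs_of_nonneg (hP x hx)]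
    rw [habs x hx] at this
    linarith

lemma bottom_of_nonpos {n : ℕ} (h : TopDrawable V n) {c : V → Bool} {A : Finset V} {r : V}
    {E : Finset (Sym2 V)} (hA : GraftTree A r E) (hn : A.card = n)
    (hc : ∀ a b, s(a, b) ∈ E → c a ≠ c b) (hr : c r = false) {P : Finset ℝ} (hPn : P.card = n)
    (hP : ∀ x ∈ P, x ≤ 0) : ∃ f, Drawing E A P r f ∧ AbsUpward c E f ∧ ∀ x ∈ P, |f r| ≤ |x| := by
  obtain ⟨f, hf, hup, hmin⟩ := h.bottom_of_nonneg hA hn hc hr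
    (P := P.image ((0 : ℝ) - ·)) (by rw [card_image_of_injective _ sub_right_injective, hPn])
    (by simpa using hP)
  refine ⟨_, hf.reflect, fun a b he ha hb => ?_, fun x hx => ?_⟩
  · simpa using hup a b he ha hb
  · simpa using hmin (0 - x) (mem_image_of_mem _ hx)

/-- A switch tree rooted at a source can be drawn with its root visible from outside and below
the highest negative and the highest nonnegative point. -/
lemma exists_visible_source {N : ℕ} (h : ∀ m < N, TopDrawable V m) {c : V → Bool} :
    ∀ (n : ℕ) {B : Finset V} {u : V} {F : Finset (Sym2 V)}, GraftTree B u F → B.card = n →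
    n ≤ N → (∀ a b, s(a, b) ∈ F → c a ≠ c b) → c u = false → ∀ {L R : Finset ℝ},
    L.Nonempty → R.Nonempty → (∀ x ∈ L, x < 0) → (∀ x ∈ R, 0 ≤ x) → L.card + R.card = n →
    Set.InjOn (fun x : ℝ => |x|) (L ∪ R : Finset ℝ) →
    ∃ f, Drawing F B (L ∪ R) u f ∧ AbsUpward c F f ∧ (∃ x ∈ L, |f u| ≤ |x|) ∧
      ∃ x ∈ R, |f u| ≤ |x| := by
  intro n
  induction n using Nat.strong_induction_on with
  | _ n ih =>
  intro B u F hB hBn hN hc hu L R hLne hRne hL hR hLR hinj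
  have hL₀ := hLne.card_pos
  have hR₀ := hRne.card_pos
  have hdisj : Disjoint L R :=
    disjoint_left.2 fun x hx hx' => absurd (hL x hx) (not_lt.2 (hR x hx'))
  have hcard : (L ∪ R).card = n := by rw [card_union_of_disjoint hdisj, hLR]
  obtain ⟨B₁, F₁, W, s, G, hB₁, hW, hd, rfl, rfl, hcase⟩ :=
    hB.exists_small_branch (x := L.card - 1) (y := R.card - 1) (by omega) (by omega)
  have hc₁ : ∀ a b, s(a, b) ∈ F₁ → c a ≠ c b := fun a b he => hc a b (by simp [he])
  have hc₂ : ∀ a b, s(a, b) ∈ G → c a ≠ c b := fun a b he => hc a b (by simp [he])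
  have hs : c s = true := by
    have := hc u s (by simp)
    rw [hu] at this
    simpa using this.symm
  have hB₁0 := hB₁.card_pos
  have hW0 := hW.card_pos
  rw [card_union_of_disjoint hd] at hBn
  rcases hcase with ⟨rfl, rfl⟩ | hcase | hcase
  · rw [card_singleton] at hBn
    have hterm : ∀ p ∈ L ∪ R, ((∀ q ∈ (L ∪ R).erase p, p < q) ∨ ∀ q ∈ (L ∪ R).erase p, q < p) →
        (∃ q ∈ (L ∪ R).erase p, |p| < |q|) →
        ∃ k : V → ℝ, k u = p ∧ Drawing (insert s(u, s) (∅ ∪ G)) ({u} ∪ W) (L ∪ R) u k ∧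
          AbsUpward c (insert s(u, s) (∅ ∪ G)) k := by
      intro p hp hend ⟨q, hq, hpq⟩
      obtain ⟨g, hg, hgup, hgmax⟩ := h W.card (by omega) c W s G hW rfl hc₂ hs
        ((L ∪ R).erase p) (by rw [card_erase_of_mem hp]; omega)
        (hinj.mono (by exact_mod_cast erase_subset _ _))
      have := Drawing.graft (c := c) hB₁ hW hd (.single (mem_singleton_self p) u) hg
        (by intro a b he; simp at he) hgup hend
        (Or.inl fun x hx => Or.inl (mem_singleton.1 hx))
        (fun _ _ => hpq.trans_le (hgmax q hq)) (fun h => by simp [hs] at h)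
      rwa [← insert_eq p, insert_erase hp] at this
    have hlL := min'_mem L hLne
    have hrR := max'_mem R hRne
    have hne : L.min' hLne ≠ R.max' hRne := ((hL _ hlL).trans_le (hR _ hrR)).ne
    rcases lt_or_ge |L.min' hLne| |R.max' hRne| with hlt | hle
    · obtain ⟨k, hku, hk, hkup⟩ := hterm (L.min' hLne) (mem_union_left _ hlL)
        (Or.inl fun q hq => lt_of_le_of_ne (by
          rcases mem_union.1 (mem_of_mem_erase hq) with hq | hq
          · exact min'_le _ _ hq
          · exact ((hL _ hlL).trans_le (hR q hq)).le) (ne_of_mem_erase hq).symm)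
        ⟨_, mem_erase.2 ⟨hne.symm, mem_union_right _ hrR⟩, hlt⟩
      exact ⟨k, hk, hkup, ⟨_, hlL, by rw [hku]⟩, _, hrR, by rw [hku]; exact hlt.le⟩
    · have hlt : |R.max' hRne| < |L.min' hLne| := lt_of_le_of_ne hle fun he =>
        hne (hinj (by simp [hlL]) (by simp [hrR]) he.symm)
      obtain ⟨k, hku, hk, hkup⟩ := hterm (R.max' hRne) (mem_union_right _ hrR)
        (Or.inr fun q hq => lt_of_le_of_ne (by
          rcases mem_union.1 (mem_of_mem_erase hq) with hq | hq
          · exact ((hL q hq).trans_le (hR _ hrR)).le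
          · exact le_max' _ _ hq) (ne_of_mem_erase hq))
        ⟨_, mem_erase.2 ⟨hne, mem_union_left _ hlL⟩, hlt⟩
      exact ⟨k, hk, hkup, ⟨_, hlL, by rw [hku]; exact hlt.le⟩, _, hrR, by rw [hku]⟩
  · obtain ⟨Q, hQL, hQ, hlt⟩ := L.exists_initial_segment (k := W.card) (by omega)
    have hQc : (L \ Q).card = L.card - W.card := by rw [card_sdiff_of_subset hQL, hQ]
    obtain ⟨g, hg, hgup, -⟩ := h W.card (by omega) c W s G hW rfl hc₂ hs Q hQ
      (hinj.mono (by exact_mod_cast hQL.trans subset_union_left))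
    obtain ⟨f, hf, hfup, ⟨x, hx, hfx⟩, y, hy, hfy⟩ := ih B₁.card (by omega) hB₁ rfl (by omega)
      hc₁ hu (L := L \ Q) (R := R) (Finset.card_pos.1 (by omega)) hRne
      (fun x hx => hL x (mem_sdiff.1 hx).1) hR (by omega)
      (hinj.mono (by exact_mod_cast union_subset_union_left sdiff_subset))
    have hsQ := hg.mem s hW.root_mem
    have hright : ∀ p ∈ L \ Q ∪ R, ∀ q ∈ Q, q < p := by
      intro p hp q hq
      rcases mem_union.1 hp with hp | hp
      · exact hlt q hq p hp
      · exact (hL q (hQL hq)).trans_le (hR p hp)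
    have hfg : |f u| < |g s| := by
      refine hfx.trans_lt ?_
      rw [abs_of_neg (hL x (mem_sdiff.1 hx).1), abs_of_neg (hL _ (hQL hsQ))]
      exact neg_lt_neg (hlt _ hsQ x hx)
    obtain ⟨k, hku, hk, hkup⟩ := Drawing.graft hB₁ hW hd hf hg hfup hgup
      (Or.inr (hright _ (hf.mem u hB₁.root_mem))) (Or.inr fun p hp => Or.inr (hright p hp))
      (fun _ _ => hfg) (fun h => by simp [hs] at h)
    have hU : L \ Q ∪ R ∪ Q = L ∪ R := by
      rw [union_right_comm, sdiff_union_of_subset hQL]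
    rw [hU] at hk
    exact ⟨k, hk, hkup, ⟨x, (mem_sdiff.1 hx).1, hku ▸ hfx⟩, y, hy, hku ▸ hfy⟩
  · obtain ⟨Q, hQR, hQ, hlt⟩ := R.exists_final_segment (k := W.card) (by omega)
    have hQc : (R \ Q).card = R.card - W.card := by rw [card_sdiff_of_subset hQR, hQ]
    obtain ⟨g, hg, hgup, -⟩ := h W.card (by omega) c W s G hW rfl hc₂ hs Q hQ
      (hinj.mono (by exact_mod_cast hQR.trans subset_union_right))
    obtain ⟨f, hf, hfup, ⟨x, hx, hfx⟩, y, hy, hfy⟩ := ih B₁.card (by omega) hB₁ rfl (by omega)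
      hc₁ hu (L := L) (R := R \ Q) hLne (Finset.card_pos.1 (by omega)) hL
      (fun x hx => hR x (mem_sdiff.1 hx).1) (by omega)
      (hinj.mono (by exact_mod_cast union_subset_union_right sdiff_subset))
    have hsQ := hg.mem s hW.root_mem
    have hleft : ∀ p ∈ L ∪ R \ Q, ∀ q ∈ Q, p < q := by
      intro p hp q hq
      rcases mem_union.1 hp with hp | hp
      · exact (hL p hp).trans_le (hR q (hQR hq))
      · exact hlt q hq p hp
    have hfg : |f u| < |g s| := by
      refine hfy.trans_lt ?_
      rw [abs_of_nonneg (hR y (mem_sdiff.1 hy).1), abs_of_nonneg (hR _ (hQR hsQ))]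
      exact hlt _ hsQ y hy
    obtain ⟨k, hku, hk, hkup⟩ := Drawing.graft hB₁ hW hd hf hg hfup hgup
      (Or.inl (hleft _ (hf.mem u hB₁.root_mem))) (Or.inl fun p hp => Or.inr (hleft p hp))
      (fun _ _ => hfg) (fun h => by simp [hs] at h)
    have hU : L ∪ R \ Q ∪ Q = L ∪ R := by
      rw [union_assoc, sdiff_union_of_subset hQR]
    rw [hU] at hk
    exact ⟨k, hk, hkup, ⟨x, hx, hku ▸ hfx⟩, y, (mem_sdiff.1 hy).1, hku ▸ hfy⟩

lemma exists_drawing_of_neg {n : ℕ} (h : ∀ m < n, TopDrawable V m) (hn : 2 ≤ n) {c : V → Bool}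
    {A : Finset V} {r : V} {E : Finset (Sym2 V)} (hA : GraftTree A r E) (hAn : A.card = n)
    (hc : ∀ a b, s(a, b) ∈ E → c a ≠ c b) (hr : c r = true) {P : Finset ℝ} (hPn : P.card = n)
    (hinj : Set.InjOn (fun x : ℝ => |x|) P) {t : ℝ} (ht : t ∈ P) (ht₀ : t < 0)
    (hmax : ∀ x ∈ P, |x| ≤ |t|) :
    ∃ f, Drawing E A P r f ∧ AbsUpward c E f ∧ ∀ x ∈ P, |x| ≤ |f r| := by
  have htlt : ∀ x ∈ P, x ≠ t → |x| < |t| := fun x hx hxt =>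
    lt_of_le_of_ne (hmax x hx) fun he => hxt (hinj hx ht he)
  have htlt' : ∀ x ∈ P.erase t, t < x := fun x hx => by
    have := htlt x (mem_of_mem_erase hx) (ne_of_mem_erase hx)
    rw [abs_of_neg ht₀] at this
    linarith [neg_abs_le x]
  set L := (P.erase t).filter (· < 0)
  set R := (P.erase t).filter (¬ · < 0)
  have hLR : L ∪ R = P.erase t := filter_union_filter_not_eq _ _
  have hLRc : L.card + R.card + 1 = n := by
    rw [card_filter_add_card_filter_not, card_erase_of_mem ht]
    omega
  have hLP : L ⊆ P.erase t := filter_subset _ _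
  have hRP : R ⊆ P.erase t := filter_subset _ _
  have hL : ∀ x ∈ L, x < 0 := fun x hx => (mem_filter.1 hx).2
  have hR : ∀ x ∈ R, 0 ≤ x := fun x hx => not_lt.1 (mem_filter.1 hx).2
  obtain ⟨A₁, E₁, B, u, F, hA₁, hB, hd, rfl, rfl, hcase⟩ :=
    hA.exists_small_branch (x := L.card) (y := R.card) (by omega) (by omega)
  have hc₁ : ∀ a b, s(a, b) ∈ E₁ → c a ≠ c b := fun a b he => hc a b (by simp [he])
  have hc₂ : ∀ a b, s(a, b) ∈ F → c a ≠ c b := fun a b he => hc a b (by simp [he])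
  have hu : c u = false := by
    have := hc r u (by simp)
    rw [hr] at this
    simpa using this.symm
  have hA₁0 := hA₁.card_pos
  have hB0 := hB.card_pos
  rw [card_union_of_disjoint hd] at hAn
  have hblock : ∀ Q ⊆ P.erase t, Q.card = B.card →
      ((∀ p ∈ P.erase t \ Q, ∀ q ∈ Q, p < q) ∨ ∀ p ∈ P.erase t \ Q, ∀ q ∈ Q, q < p) →
      (∃ g, Drawing F B Q u g ∧ AbsUpward c F g) →
      ∃ f, Drawing (insert s(r, u) (E₁ ∪ F)) (A₁ ∪ B) P r f ∧
        AbsUpward c (insert s(r, u) (E₁ ∪ F)) f ∧ ∀ x ∈ P, |x| ≤ |f r| := by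
    intro Q hQP hQ hside ⟨g, hg, hgup⟩
    have hQP' : Q ⊆ P := hQP.trans (erase_subset _ _)
    have htQ : t ∈ P \ Q := mem_sdiff.2 ⟨ht, fun h => notMem_erase t P (hQP h)⟩
    obtain ⟨f, hf, hfup, hfmax⟩ := h A₁.card (by omega) c A₁ r E₁ hA₁ rfl hc₁ hr (P \ Q)
      (by rw [card_sdiff_of_subset hQP']; omega) (hinj.mono (by exact_mod_cast sdiff_subset))
    have hfr : f r = t := by
      have hm := (mem_sdiff.1 (hf.mem r hA₁.root_mem)).1
      exact hinj hm ht (le_antisymm (hmax _ hm) (hfmax t htQ))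
    have hmem : ∀ p ∈ P \ Q, p ≠ t → p ∈ P.erase t \ Q := fun p hp hpt => by
      rw [mem_sdiff] at hp
      exact mem_sdiff.2 ⟨mem_erase.2 ⟨hpt, hp.1⟩, hp.2⟩
    obtain ⟨k, hkr, hk, hkup⟩ := Drawing.graft hA₁ hB hd hf hg hfup hgup
      (Or.inl fun q hq => hfr ▸ htlt' q (hQP hq))
      (by
        rw [hfr]
        refine hside.imp (fun h p hp => ?_) (fun h p hp => ?_) <;>
        exact or_iff_not_imp_left.2 fun hpt => h p (hmem p hp hpt))
      (fun h => by simp [hr] at h)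
      (fun _ _ => by
        have := hQP (hg.mem u hB.root_mem)
        exact hfr ▸ htlt _ (mem_of_mem_erase this) (ne_of_mem_erase this))
    rw [sdiff_union_of_subset hQP'] at hk
    exact ⟨k, hk, hkup, by rwa [hkr, hfr]⟩
  have hleft : B.card ≤ L.card →
      ∃ f, Drawing (insert s(r, u) (E₁ ∪ F)) (A₁ ∪ B) P r f ∧
        AbsUpward c (insert s(r, u) (E₁ ∪ F)) f ∧ ∀ x ∈ P, |x| ≤ |f r| := fun hle => by
    obtain ⟨Q, hQL, hQ, hlt⟩ := L.exists_initial_segment hle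
    obtain ⟨g, hg, hgup, -⟩ := (h B.card (by omega)).bottom_of_nonpos hB rfl hc₂ hu hQ
      (fun x hx => (hL x (hQL hx)).le)
    refine hblock Q (hQL.trans hLP) hQ (Or.inr fun p hp q hq => ?_) ⟨g, hg, hgup⟩
    rw [← hLR, mem_sdiff, mem_union] at hp
    rcases hp.1 with hp' | hp'
    · exact hlt q hq p (mem_sdiff.2 ⟨hp', hp.2⟩)
    · exact (hL q (hQL hq)).trans_le (hR p hp')
  have hright : B.card ≤ R.card →
      ∃ f, Drawing (insert s(r, u) (E₁ ∪ F)) (A₁ ∪ B) P r f ∧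
        AbsUpward c (insert s(r, u) (E₁ ∪ F)) f ∧ ∀ x ∈ P, |x| ≤ |f r| := fun hle => by
    obtain ⟨Q, hQR, hQ, hlt⟩ := R.exists_final_segment hle
    obtain ⟨g, hg, hgup, -⟩ := (h B.card (by omega)).bottom_of_nonneg hB rfl hc₂ hu hQ
      (fun x hx => hR x (hQR hx))
    refine hblock Q (hQR.trans hRP) hQ (Or.inl fun p hp q hq => ?_) ⟨g, hg, hgup⟩
    rw [← hLR, mem_sdiff, mem_union] at hp
    rcases hp.1 with hp' | hp'
    · exact (hL p hp').trans_le (hR q (hQR hq))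
    · exact hlt q hq p (mem_sdiff.2 ⟨hp', hp.2⟩)
  rcases hcase with ⟨rfl, rfl⟩ | hle | hle
  · rw [card_singleton] at hAn
    by_cases hl : B.card ≤ L.card
    · exact hleft hl
    by_cases hr' : B.card ≤ R.card
    · exact hright hr'
    have hinj' : Set.InjOn (fun x : ℝ => |x|) (P.erase t : Finset ℝ) :=
      hinj.mono (by exact_mod_cast erase_subset _ _)
    obtain ⟨g, hg, hgup, -⟩ := exists_visible_source h B.card hB rfl (by omega) hc₂ hu
      (Finset.card_pos.1 (by omega)) (Finset.card_pos.1 (by omega)) hL hR (by omega)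
      (by rwa [hLR])
    rw [hLR] at hg
    exact hblock (P.erase t) subset_rfl (by rw [card_erase_of_mem ht]; omega) (by simp)
      ⟨g, hg, hgup⟩
  · exact hleft hle
  · exact hright hle

end TopDrawable

lemma topDrawable (V : Type*) [DecidableEq V] (n : ℕ) : TopDrawable V n := by
  induction n using Nat.strong_induction_on with
  | _ n ih =>
  intro c A r E hA hAn hc hr P hPn hinj
  have hne : P.Nonempty := Finset.card_pos.1 (by have := hA.card_pos; omega)
  obtain ⟨t, ht, hmax⟩ := P.exists_max_image (fun x => |x|) hne
  rcases le_or_gt n 1 with hn | hn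
  · cases hA with
    | single r => exact ⟨_, .single ht r, by intro a b he; simp at he, hmax⟩
    | graft h₁ h₂ hd =>
      have := h₁.card_pos
      have := h₂.card_pos
      rw [card_union_of_disjoint hd] at hAn
      omega
  · rcases lt_or_ge t 0 with ht₀ | ht₀
    · exact TopDrawable.exists_drawing_of_neg ih hn hA hAn hc hr hPn hinj ht ht₀ hmax
    · have ht₁ : t ≠ 0 := by
        rintro rfl
        have hsub : P ⊆ {0} := fun x hx => by
          have := hmax x hx
          simpa using this
        have := card_le_card hsub
        simp at this
        omega
      have hinj' : Set.InjOn (fun x : ℝ => |x|) (P.image ((0 : ℝ) - ·) : Finset ℝ) := by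
        intro x hx y hy hxy
        obtain ⟨x, hx', rfl⟩ := mem_image.1 hx
        obtain ⟨y, hy', rfl⟩ := mem_image.1 hy
        simp only [zero_sub, abs_neg] at hxy
        rw [hinj hx' hy' hxy]
      obtain ⟨f, hf, hfup, hfmax⟩ := TopDrawable.exists_drawing_of_neg ih hn hA hAn hc hr
        (P := P.image ((0 : ℝ) - ·))
        (by rw [card_image_of_injective _ sub_right_injective, hPn]) hinj'
        (mem_image_of_mem _ ht) (by simpa using lt_of_le_of_ne ht₀ ht₁.symm)
        (by simpa using hmax)
      refine ⟨_, hf.reflect, fun a b he ha hb => ?_, fun x hx => ?_⟩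
      · simpa using hfup a b he ha hb
      · simpa using hfmax (0 - x) (mem_image_of_mem _ hx)

/-! ### Points in convex position -/

lemma not_between_of_convexPos {S : Finset (ℝ × ℝ)} (hS : ConvexPos S) {m a₁ a₂ b₁ b₂ : ℝ × ℝ}
    (hm : m ∈ S) (ha₁ : a₁ ∈ S) (ha₂ : a₂ ∈ S) (hb₁ : b₁ ∈ S) (hb₂ : b₂ ∈ S)
    (h₁ : a₁.2 < m.2) (h₂ : m.2 < a₂.2) (h₃ : b₁.2 < m.2) (h₄ : m.2 < b₂.2)
    (ha : det2 (a₂ - a₁) (m - a₁) ≤ 0) (hb : 0 ≤ det2 (b₂ - b₁) (m - b₁)) : False := by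
  have hmem : ∀ x ∈ S, x.2 ≠ m.2 → x ∈ convexHull ℝ (↑(S.erase m) : Set (ℝ × ℝ)) :=
    fun x hx hxm => subset_convexHull ℝ _ (mem_erase.2 ⟨fun h => hxm (h ▸ rfl), hx⟩)
  have hconv : Convex ℝ (convexHull ℝ (↑(S.erase m) : Set (ℝ × ℝ))) := convex_convexHull ℝ _
  have hpt : ∀ x ∈ S, ∀ y ∈ S, x.2 < m.2 → m.2 < y.2 →
      (x.1 + (m.2 - x.2) / (y.2 - x.2) * (y.1 - x.1), m.2) ∈
        convexHull ℝ (↑(S.erase m) : Set (ℝ × ℝ)) := by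
    intro x hx y hy hxm hmy
    refine hconv.segment_subset (hmem x hx hxm.ne) (hmem y hy hmy.ne') ?_
    have hpos : 0 < y.2 - x.2 := by linarith
    refine ⟨1 - (m.2 - x.2) / (y.2 - x.2), (m.2 - x.2) / (y.2 - x.2), ?_, ?_, by ring, ?_⟩
    · rw [sub_nonneg, div_le_one hpos]
      linarith
    · exact div_nonneg (by linarith) hpos.le
    · ext
      · simp
        ring
      · simp
        field_simp
        ring
  refine hS.2 m hm (hconv.segment_subset (hpt a₁ ha₁ a₂ ha₂ h₁ h₂) (hpt b₁ hb₁ b₂ hb₂ h₃ h₄) ?_)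
  rw [← Prod.image_mk_segment_left]
  refine ⟨m.1, ?_, rfl⟩
  simp only [det2, Prod.fst_sub, Prod.snd_sub] at ha hb
  have hle : a₁.1 + (m.2 - a₁.2) / (a₂.2 - a₁.2) * (a₂.1 - a₁.1) ≤ m.1 := by
    have : 0 < a₂.2 - a₁.2 := by linarith
    rw [div_mul_eq_mul_div, ← le_sub_iff_add_le', div_le_iff₀ this]
    linarith
  have hge : m.1 ≤ b₁.1 + (m.2 - b₁.2) / (b₂.2 - b₁.2) * (b₂.1 - b₁.1) := by
    have : 0 < b₂.2 - b₁.2 := by linarith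
    rw [div_mul_eq_mul_div, ← sub_le_iff_le_add', le_div_iff₀ this]
    linarith
  rw [segment_eq_Icc (hle.trans hge)]
  exact ⟨hle, hge⟩

/-- Position of `p` along the boundary of a convex point set, read counterclockwise from the
highest point `t` through the lowest point `b`; its absolute value is the height above `b`. -/
def chainPos (b t p : ℝ × ℝ) : ℝ :=
  if 0 ≤ det2 (t - b) (p - b) then -(p.2 - b.2) else p.2 - b.2

lemma abs_chainPos {b t p : ℝ × ℝ} (h : b.2 ≤ p.2) : |chainPos b t p| = p.2 - b.2 := by
  unfold chainPos
  split_ifs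
  · rw [abs_neg, abs_of_nonneg (sub_nonneg.2 h)]
  · rw [abs_of_nonneg (sub_nonneg.2 h)]

lemma det2_pos_of_chainPos_lt {S : Finset (ℝ × ℝ)} (hS : ConvexPos S) {b t : ℝ × ℝ}
    (hb : IsLowest S b) (ht : IsHighest S t) {p q r : ℝ × ℝ} (hp : p ∈ S) (hq : q ∈ S)
    (hr : r ∈ S) (hpq : chainPos b t p < chainPos b t q)
    (hqr : chainPos b t q < chainPos b t r) : 0 < det2 (q - p) (r - p) := by
  have hbp := hb.2 p hp
  have hbq := hb.2 q hq
  have hbr := hb.2 r hr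
  have hpt := ht.2 p hp
  have hqt := ht.2 q hq
  have hrt := ht.2 r hr
  have key : (t.2 - b.2) * det2 (q - p) (r - p) = det2 (t - b) (r - b) * (q.2 - p.2) +
      det2 (t - b) (p - b) * (r.2 - q.2) + det2 (t - b) (q - b) * (p.2 - r.2) := by
    simp only [det2, Prod.fst_sub, Prod.snd_sub]
    ring
  have hcyc : det2 (q - p) (r - p) = det2 (r - q) (p - q) := by
    simp only [det2, Prod.fst_sub, Prod.snd_sub]
    ring
  have hcyc' : det2 (q - p) (r - p) = det2 (p - r) (q - r) := by
    simp only [det2, Prod.fst_sub, Prod.snd_sub]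
    ring
  have hanti : ∀ x y z : ℝ × ℝ, det2 (y - x) (z - x) = -det2 (x - y) (z - y) := by
    intro x y z
    simp only [det2, Prod.fst_sub, Prod.snd_sub]
    ring
  have hanti' : ∀ x y z : ℝ × ℝ, det2 (y - x) (z - x) = -det2 (z - x) (y - x) := by
    intro x y z
    simp only [det2, Prod.fst_sub, Prod.snd_sub]
    ring
  by_contra! hneg
  unfold chainPos at hpq hqr
  rcases le_or_gt 0 (det2 (t - b) (p - b)) with hDp | hDp <;>
  rcases le_or_gt 0 (det2 (t - b) (q - b)) with hDq | hDq <;>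
  rcases le_or_gt 0 (det2 (t - b) (r - b)) with hDr | hDr <;>
  simp only [hDp, hDq, hDr, not_le.2, if_true, if_false] at hpq hqr
  · exact not_between_of_convexPos hS hq hr hp hb.1 ht.1 (by linarith) (by linarith)
      (by linarith) (by linarith) (hcyc' ▸ hneg) hDq
  · rcases lt_or_ge p.2 r.2 with h | h
    · exact not_between_of_convexPos hS hp hq hr hb.1 ht.1 (by linarith) h
        (by linarith) (by linarith) (hcyc ▸ hneg) hDp
    rcases lt_or_ge r.2 q.2 with h' | h'
    · exact not_between_of_convexPos hS hq hr hp hb.1 ht.1 h' (by linarith)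
        (by linarith) (by linarith) (hcyc' ▸ hneg) hDq
    · have h₁ := mul_nonneg hDp (sub_nonneg.2 h')
      have h₂ := mul_nonneg hDq (sub_nonneg.2 h)
      have h₃ : 0 < det2 (t - b) (r - b) * (q.2 - p.2) :=
        mul_pos_of_neg_of_neg hDr (by linarith)
      have h₄ := mul_nonpos_of_nonneg_of_nonpos (show 0 ≤ t.2 - b.2 by linarith) hneg
      linarith
  · linarith
  · rcases lt_or_ge r.2 p.2 with h | h
    · refine not_between_of_convexPos hS hr hb.1 ht.1 hq hp (by linarith) (by linarith)
        (by linarith) h hDr.le ?_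
      rw [hcyc, hanti'] at hneg
      linarith
    rcases lt_or_ge p.2 q.2 with h' | h'
    · refine not_between_of_convexPos hS hq hb.1 ht.1 hp hr (by linarith) (by linarith)
        h' (by linarith) hDq.le ?_
      rw [hanti'] at hneg
      linarith
    · have h₁ := mul_nonneg hDp (show 0 ≤ r.2 - q.2 by linarith)
      have h₂ := mul_nonneg_of_nonpos_of_nonpos hDr.le (sub_nonpos.2 h')
      have h₃ := mul_nonneg_of_nonpos_of_nonpos hDq.le (sub_nonpos.2 h)
      have h₄ := mul_nonpos_of_nonneg_of_nonpos (show 0 ≤ t.2 - b.2 by linarith) hneg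
      rcases h'.eq_or_lt with h₅ | h₅
      · have : 0 < det2 (t - b) (q - b) * (p.2 - r.2) :=
          mul_pos_of_neg_of_neg hDq (by linarith)
        linarith
      · have : 0 < det2 (t - b) (r - b) * (q.2 - p.2) :=
          mul_pos_of_neg_of_neg hDr (by linarith)
        linarith
  · linarith
  · linarith
  · linarith
  · refine not_between_of_convexPos hS hq hb.1 ht.1 hp hr (by linarith) (by linarith)
      (by linarith) (by linarith) hDq.le ?_
    rw [hanti'] at hneg
    linarith

lemma eq_of_mem_segments {a b d p : ℝ × ℝ} (h : det2 (b - a) (d - a) ≠ 0)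
    (hp : p ∈ segment ℝ a b) (hp' : p ∈ segment ℝ a d) : p = a := by
  rw [segment_eq_image'] at hp hp'
  obtain ⟨x, -, rfl⟩ := hp
  obtain ⟨y, -, hy⟩ := hp'
  have h₁ := congrArg Prod.fst hy
  have h₂ := congrArg Prod.snd hy
  simp only [Prod.fst_add, Prod.snd_add, Prod.smul_fst, Prod.smul_snd, Prod.fst_sub,
    Prod.snd_sub, smul_eq_mul] at h₁ h₂
  have hx : x * det2 (b - a) (d - a) = 0 := by
    simp only [det2, Prod.fst_sub, Prod.snd_sub]
    linear_combination (a.2 - d.2) * h₁ + (d.1 - a.1) * h₂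
  simp [(mul_eq_zero.1 hx).resolve_right h]

lemma notMem_segment_of_same_side {a b c d p : ℝ × ℝ}
    (h : 0 < det2 (b - a) (c - a) * det2 (b - a) (d - a)) (hp : p ∈ segment ℝ a b) :
    p ∉ segment ℝ c d := by
  rintro ⟨x, y, hx, hy, hxy, rfl⟩
  rw [segment_eq_image'] at hp
  obtain ⟨z, -, hz⟩ := hp
  have h₁ := congrArg Prod.fst hz
  have h₂ := congrArg Prod.snd hz
  simp only [Prod.fst_add, Prod.snd_add, Prod.smul_fst, Prod.smul_snd, Prod.fst_sub,
    Prod.snd_sub, smul_eq_mul] at h₁ h₂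
  have h₀ : x * det2 (b - a) (c - a) + y * det2 (b - a) (d - a) = 0 := by
    obtain rfl : x = 1 - y := by linarith
    simp only [det2, Prod.fst_sub, Prod.snd_sub]
    linear_combination (b.2 - a.2) * h₁ + (a.1 - b.1) * h₂
  rcases hx.eq_or_lt with rfl | hx'
  · obtain rfl : y = 1 := by linarith
    rw [zero_mul, one_mul, zero_add] at h₀
    simp [h₀] at h
  · rcases mul_pos_iff.1 h with ⟨hc, hd⟩ | ⟨hc, hd⟩
    · linarith [mul_pos hx' hc, mul_nonneg hy hd.le]
    · linarith [mul_neg_of_pos_of_neg hx' hc, mul_nonpos_of_nonneg_of_nonpos hy hd.le]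

/-- Two segments meet only at common endpoints if their endpoints do not interleave along a
numbering `σ` of the points for which increasing triples turn left. -/
lemma mem_endpoints_of_mem_segments {S : Finset (ℝ × ℝ)} {σ : ℝ × ℝ → ℝ}
    (hσ : Set.InjOn σ S)
    (hdet : ∀ p ∈ S, ∀ q ∈ S, ∀ r ∈ S, σ p < σ q → σ q < σ r → 0 < det2 (q - p) (r - p))
    {a b c d p : ℝ × ℝ} (ha : a ∈ S) (hb : b ∈ S) (hc : c ∈ S) (hd : d ∈ S)
    (hab : a ≠ b) (hcd : c ≠ d) (hne : s(a, b) ≠ s(c, d))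
    (hcross : ∀ x y z w, s(x, y) = s(a, b) → s(z, w) = s(c, d) →
      ¬ (σ x < σ z ∧ σ z < σ y ∧ σ y < σ w) ∧ ¬ (σ z < σ x ∧ σ x < σ w ∧ σ w < σ y))
    (hp : p ∈ segment ℝ a b) (hp' : p ∈ segment ℝ c d) :
    p ∈ ({a, b} : Set (ℝ × ℝ)) ∧ p ∈ ({c, d} : Set (ℝ × ℝ)) := by
  have hrot : ∀ x y z : ℝ × ℝ, det2 (y - x) (z - x) = det2 (z - y) (x - y) := by
    intro x y z
    simp only [det2, Prod.fst_sub, Prod.snd_sub]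
    ring
  have hanti : ∀ x y z : ℝ × ℝ, det2 (y - x) (z - x) = -det2 (z - x) (y - x) := by
    intro x y z
    simp only [det2, Prod.fst_sub, Prod.snd_sub]
    ring
  have hanti' : ∀ x y z : ℝ × ℝ, det2 (y - x) (z - x) = -det2 (x - y) (z - y) := by
    intro x y z
    simp only [det2, Prod.fst_sub, Prod.snd_sub]
    ring
  have hlt : ∀ x ∈ S, ∀ y ∈ S, x ≠ y → σ x < σ y ∨ σ y < σ x := fun x hx y hy hxy =>
    lt_or_gt_of_ne fun h => hxy (hσ hx hy h)
  have hside : ∀ x ∈ S, ∀ y ∈ S, ∀ z ∈ S, σ x < σ y → x ≠ z → y ≠ z →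
      ((σ z < σ x ∨ σ y < σ z) ∧ 0 < det2 (y - x) (z - x)) ∨
      ((σ x < σ z ∧ σ z < σ y) ∧ det2 (y - x) (z - x) < 0) := by
    intro x hx y hy z hz hxy hxz hyz
    rcases hlt x hx z hz hxz with h | h
    · rcases hlt y hy z hz hyz with h' | h'
      · exact Or.inl ⟨Or.inr h', hdet x hx y hy z hz hxy h'⟩
      · refine Or.inr ⟨⟨h, h'⟩, ?_⟩
        rw [hanti, neg_lt_zero]
        exact hdet x hx z hz y hy h h'
    · refine Or.inl ⟨Or.inl h, ?_⟩
      rw [hrot, hrot]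
      exact hdet z hz x hx y hy h hxy
  have hnz : ∀ x ∈ S, ∀ y ∈ S, ∀ z ∈ S, x ≠ y → x ≠ z → y ≠ z →
      det2 (y - x) (z - x) ≠ 0 := by
    intro x hx y hy z hz hxy hxz hyz
    rcases hlt x hx y hy hxy with h | h
    · rcases hside x hx y hy z hz h hxz hyz with h' | h'
      exacts [h'.2.ne', h'.2.ne]
    · rw [hanti', neg_ne_zero]
      rcases hside y hy x hx z hz h hyz hxz with h' | h'
      exacts [h'.2.ne', h'.2.ne]
  have hsame : ∀ x ∈ S, ∀ y ∈ S, s(x, y) = s(a, b) → x ≠ c → x ≠ d → y ≠ c → y ≠ d →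
      σ x < σ y → 0 < det2 (y - x) (c - x) * det2 (y - x) (d - x) := by
    intro x hx y hy he hxc hxd hyc hyd h
    have h₁ := hcross x y c d he rfl
    have h₂ := hcross x y d c he Sym2.eq_swap
    rcases hside x hx y hy c hc h hxc hyc with ⟨hc₁, hc₂⟩ | ⟨hc₁, hc₂⟩ <;>
    rcases hside x hx y hy d hd h hxd hyd with ⟨hd₁, hd₂⟩ | ⟨hd₁, hd₂⟩
    · exact mul_pos hc₂ hd₂
    · rcases hc₁ with hc₁ | hc₁
      · exact absurd ⟨hc₁, hd₁⟩ h₁.2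
      · exact absurd ⟨hd₁.1, hd₁.2, hc₁⟩ h₂.1
    · rcases hd₁ with hd₁ | hd₁
      · exact absurd ⟨hd₁, hc₁⟩ h₂.2
      · exact absurd ⟨hc₁.1, hc₁.2, hd₁⟩ h₁.1
    · exact mul_pos_of_neg_of_neg hc₂ hd₂
  by_cases hac : a = c
  · subst hac
    have hbd : b ≠ d := fun h => hne (h ▸ rfl)
    obtain rfl := eq_of_mem_segments (hnz a ha b hb d hd hab hcd hbd) hp hp'
    simp
  by_cases had : a = d
  · subst had
    have hbc : b ≠ c := fun h => hne (h ▸ Sym2.eq_swap)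
    rw [segment_symm ℝ c] at hp'
    obtain rfl := eq_of_mem_segments (hnz a ha b hb c hc hab hac hbc) hp hp'
    simp
  by_cases hbc : b = c
  · subst hbc
    rw [segment_symm ℝ a] at hp
    obtain rfl := eq_of_mem_segments (hnz b hb a ha d hd hab.symm hcd had) hp hp'
    simp
  by_cases hbd : b = d
  · subst hbd
    rw [segment_symm ℝ a] at hp
    rw [segment_symm ℝ c] at hp'
    obtain rfl := eq_of_mem_segments (hnz b hb a ha c hc hab.symm hbc hac) hp hp'
    simp
  rcases hlt a ha b hb hab with h | h
  · exact absurd hp' (notMem_segment_of_same_side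
      (hsame a ha b hb rfl hac had hbc hbd h) hp)
  · exact absurd hp' (notMem_segment_of_same_side
      (hsame b hb a ha Sym2.eq_swap hbc hbd hac had h) (segment_symm ℝ a b ▸ hp))

theorem switch_tree_UPSE_convex {V : Type} [Fintype V] (Adj : V → V → Prop)
    (hT : IsDirTree Adj) (hsw : IsSwitch Adj)
    (S : Finset (ℝ × ℝ)) (hS : ConvexPos S) (hcard : S.card = Fintype.card V) :
    ∃ f : V → ℝ × ℝ, UPSE Adj S f := by
  classical
  obtain ⟨-, hloop, htree⟩ := hT
  have hne : S.Nonempty := by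
    rw [← Finset.card_pos, hcard, Fintype.card_pos_iff]
    exact htree.connected.nonempty
  obtain ⟨b, hb⟩ : ∃ b, IsLowest S b := S.exists_min_image Prod.snd hne
  obtain ⟨t, ht⟩ : ∃ t, IsHighest S t := S.exists_max_image Prod.snd hne
  have habs : ∀ p ∈ S, |chainPos b t p| = p.2 - b.2 := fun p hp => abs_chainPos (hb.2 p hp)
  have hy : ∀ p ∈ S, ∀ q ∈ S, |chainPos b t p| = |chainPos b t q| → p = q := by
    intro p hp q hq h
    rw [habs p hp, habs q hq, sub_left_inj] at h
    by_contra hpq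
    exact hS.1.1 p hp q hq hpq h
  have hσ : Set.InjOn (chainPos b t) S := fun p hp q hq h => hy p hp q hq (by rw [h])
  have hinj : Set.InjOn (fun x : ℝ => |x|) (S.image (chainPos b t) : Finset ℝ) := by
    intro x hx y hy' hxy
    obtain ⟨p, hp, rfl⟩ := mem_image.1 hx
    obtain ⟨q, hq, rfl⟩ := mem_image.1 hy'
    rw [hy p hp q hq hxy]
  set E := (SimpleGraph.fromRel Adj).edgeFinset
  have hE : ∀ u v, s(u, v) ∈ E ↔ u ≠ v ∧ (Adj u v ∨ Adj v u) := by simp [E]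
  have hAdjE : ∀ u v, Adj u v → s(u, v) ∈ E := fun u v h =>
    (hE u v).2 ⟨fun huv => hloop v (huv ▸ h), Or.inl h⟩
  obtain ⟨c, hc, r, hcr⟩ : ∃ c : V → Bool, (∀ u v, Adj u v → c u = false ∧ c v = true) ∧
      ∃ r, c r = true := by
    by_cases harc : ∃ u v, Adj u v
    · obtain ⟨u₀, v₀, h₀⟩ := harc
      refine ⟨fun v => decide (∃ u, Adj u v), fun u v h => ⟨?_, ?_⟩, v₀, by simpa using ⟨u₀, h₀⟩⟩
      · simpa using (hsw u).resolve_right fun h' => h' v h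
      · simpa using ⟨u, h⟩
    · obtain ⟨r⟩ := htree.connected.nonempty
      exact ⟨fun _ => true, fun u v h => absurd ⟨u, v, h⟩ harc, r, rfl⟩
  have hcE : ∀ u v, s(u, v) ∈ E → c u ≠ c v := by
    intro u v he
    rcases ((hE u v).1 he).2 with h | h <;> simp [hc _ _ h]
  obtain ⟨f, hf, hup, -⟩ := topDrawable V (Fintype.card V) c univ r E (htree.graftTree r)
    card_univ hcE hcr (S.image (chainPos b t)) (by rw [card_image_of_injOn hσ, hcard]) hinj
  choose g hgS hgf using fun v => mem_image.1 (hf.mem v (mem_univ v))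
  have hg : Function.Injective g := fun u v h =>
    hf.injOn (by simp) (by simp) (by rw [← hgf u, ← hgf v, h])
  refine ⟨g, hg, hgS, ?_, ?_⟩
  · intro u v h
    have := hup u v (hAdjE u v h) (hc u v h).1 (hc u v h).2
    rw [← hgf u, ← hgf v, habs _ (hgS u), habs _ (hgS v)] at this
    linarith
  · intro u v u' v' h h' hne' p hp hp'
    have hedge : ∀ {x y u v}, s(x, y) = s(g u, g v) → Adj u v →
        ∃ x' y', s(x', y') ∈ E ∧ chainPos b t x = f x' ∧ chainPos b t y = f y' := by
      intro x y u v he hadj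
      rcases Sym2.eq_iff.1 he with ⟨rfl, rfl⟩ | ⟨rfl, rfl⟩
      · exact ⟨u, v, hAdjE u v hadj, hgf u, hgf v⟩
      · exact ⟨v, u, Sym2.eq_swap ▸ hAdjE u v hadj, hgf v, hgf u⟩
    refine mem_endpoints_of_mem_segments hσ
      (fun p hp q hq r hr => det2_pos_of_chainPos_lt hS hb ht hp hq hr)
      (hgS u) (hgS v) (hgS u') (hgS v') (fun he => hloop v (hg he ▸ h))
      (fun he => hloop v' (hg he ▸ h')) ?_ ?_ hp hp'
    · intro he
      rcases Sym2.eq_iff.1 he with ⟨h₁, h₂⟩ | ⟨h₁, h₂⟩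
      · exact hne' (by rw [hg h₁, hg h₂])
      · have h₃ := (hc _ _ h).1
        rw [hg h₁, (hc _ _ h').2] at h₃
        exact Bool.noConfusion h₃
    · intro x y z w hxy hzw
      obtain ⟨x', y', he, hx, hy⟩ := hedge hxy h
      obtain ⟨z', w', he', hz, hw⟩ := hedge hzw h'
      rw [hx, hy, hz, hw]
      exact ⟨hf.noncrossing _ _ _ _ he he', hf.noncrossing _ _ _ _ he' he⟩
end
end

section
/- Let T be a switch tree with a sink r, and let S be any convex point set with |S| = |T|. Then T admits an upward planar straight-line embedding into S such that r is mapped to the highest point of S. -/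
open Finset

noncomputable section

/-- `RootedBuild G v A` says that `A` is assembled, starting from single vertices, by repeatedly
joining two disjoint pieces along the root edge that is the only edge of `G` between them;
`v` is the root of `A`. -/
inductive RootedBuild {V : Type*} [DecidableEq V] (G : SimpleGraph V) : V → Finset V → Prop
  | single (v : V) : RootedBuild G v {v}
  | glue {u w : V} {A B : Finset V} : RootedBuild G u A → RootedBuild G w B → Disjoint A B →
      G.Adj u w → (∀ a ∈ A, ∀ b ∈ B, G.Adj a b → a = u ∧ b = w) → RootedBuild G u (A ∪ B)

theorem RootedBuild.root_mem {V : Type*} [DecidableEq V] {G : SimpleGraph V} {v : V}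
    {A : Finset V} (h : RootedBuild G v A) : v ∈ A := by
  induction h with
  | single v => simp
  | glue _ _ _ _ _ ih _ => exact mem_union_left _ ih

theorem RootedBuild.mono {V : Type*} [DecidableEq V] {G G' : SimpleGraph V} {v : V}
    {A : Finset V} (h : RootedBuild G v A) (hle : G ≤ G')
    (hA : ∀ a ∈ A, ∀ b ∈ A, G'.Adj a b → G.Adj a b) : RootedBuild G' v A := by
  induction h with
  | single v => exact .single v
  | glue _ _ hd huw hcross ih1 ih2 =>
    refine .glue (ih1 fun a ha b hb ↦ ?_) (ih2 fun a ha b hb ↦ ?_) hd (hle huw)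
      fun a ha b hb hab ↦ ?_
    · exact hA a (mem_union_left _ ha) b (mem_union_left _ hb)
    · exact hA a (mem_union_right _ ha) b (mem_union_right _ hb)
    · exact hcross a ha b hb (hA a (mem_union_left _ ha) b (mem_union_right _ hb) hab)

theorem reachable_deleteEdges_or {V : Type*} {G : SimpleGraph V} {v w x : V}
    (h : G.Reachable v x) :
    (G.deleteEdges {s(v, w)}).Reachable v x ∨ (G.deleteEdges {s(v, w)}).Reachable w x := by
  rw [SimpleGraph.reachable_iff_reflTransGen] at h
  induction h with
  | refl => exact Or.inl .rfl
  | @tail y z _ hyz ih =>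
    by_cases he : s(y, z) = s(v, w)
    · rcases Sym2.eq_iff.1 he with ⟨_, rfl⟩ | ⟨_, rfl⟩
      · exact Or.inr .rfl
      · exact Or.inl .rfl
    · have hadj : (G.deleteEdges {s(v, w)}).Adj y z := by
        rw [SimpleGraph.deleteEdges_adj]
        exact ⟨hyz, he⟩
      exact ih.imp (·.trans hadj.reachable) (·.trans hadj.reachable)

theorem rootedBuild_reachable {V : Type*} [Fintype V] [DecidableEq V] (G : SimpleGraph V)
    (hG : G.IsAcyclic) (v : V) [DecidablePred (G.Reachable v)] :
    RootedBuild G v (univ.filter (G.Reachable v)) := by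
  classical
  induction G using WellFoundedLT.induction generalizing v with
  | ind G ih =>
  by_cases hv : ∃ w, G.Adj v w
  · obtain ⟨w, hvw⟩ := hv
    set G' := G.deleteEdges {s(v, w)} with hG'
    have hle : G' ≤ G := G.deleteEdges_le _
    have hnot : ¬ G'.Adj v w := by simp [hG']
    have hlt : G' < G := hle.lt_of_ne (by rintro h; rw [h] at hnot; exact hnot hvw)
    have hadj : ∀ {a b}, G.Adj a b → G'.Adj a b ∨ (a = v ∧ b = w) ∨ (a = w ∧ b = v) := by
      intro a b hab
      simp only [hG', SimpleGraph.deleteEdges_adj, Set.mem_singleton_iff, Sym2.eq_iff]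
      tauto
    have hbr : ¬ G'.Reachable v w :=
      SimpleGraph.isBridge_iff.1 (SimpleGraph.isAcyclic_iff_forall_isBridge.1 hG
        (G.mem_edgeSet.2 hvw))
    have hac := hG.anti hle
    have hdis : ∀ {x}, G'.Reachable v x → G'.Reachable w x → False :=
      fun h1 h2 ↦ hbr (h1.trans h2.symm)
    have hU : univ.filter (G.Reachable v) =
        univ.filter (G'.Reachable v) ∪ univ.filter (G'.Reachable w) := by
      ext x
      simp only [mem_filter, mem_univ, true_and, mem_union]
      exact ⟨reachable_deleteEdges_or, fun h ↦ h.elim (·.mono hle)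
        fun h ↦ hvw.reachable.trans (h.mono hle)⟩
    rw [hU]
    refine .glue ((ih G' hlt hac v).mono hle ?_) ((ih G' hlt hac w).mono hle ?_) ?_ hvw ?_
    · intro a ha b hb hab
      simp only [mem_filter, mem_univ, true_and] at ha hb
      rcases hadj hab with h | ⟨rfl, rfl⟩ | ⟨rfl, rfl⟩
      · exact h
      · exact (hbr hb).elim
      · exact (hbr ha).elim
    · intro a ha b hb hab
      simp only [mem_filter, mem_univ, true_and] at ha hb
      rcases hadj hab with h | ⟨rfl, rfl⟩ | ⟨rfl, rfl⟩
      · exact h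
      · exact (hbr ha.symm).elim
      · exact (hbr hb.symm).elim
    · rw [Finset.disjoint_left]
      intro x h1 h2
      simp only [mem_filter, mem_univ, true_and] at h1 h2
      exact hdis h1 h2
    · intro a ha b hb hab
      simp only [mem_filter, mem_univ, true_and] at ha hb
      rcases hadj hab with h | h | ⟨rfl, rfl⟩
      · exact (hdis (ha.trans h.reachable) hb).elim
      · exact h
      · exact (hbr ha).elim
  · have : univ.filter (G.Reachable v) = {v} := by
      ext x
      simp only [mem_filter, mem_univ, true_and, mem_singleton]
      refine ⟨fun h ↦ ?_, fun h ↦ h ▸ .rfl⟩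
      rw [SimpleGraph.reachable_iff_reflTransGen] at h
      rcases h.cases_head with h | ⟨c, hc, _⟩
      · exact h.symm
      · exact (hv ⟨c, hc⟩).elim
    rw [this]
    exact .single v

/-- The heights `y a, …, y (a + k - 1)` are pairwise distinct and first decrease, then increase. -/
def Valley (y : ℕ → ℝ) (a k : ℕ) : Prop :=
  (∀ i j, a ≤ i → i < j → j < a + k → y i ≠ y j) ∧
  ∀ i j l, a ≤ i → i < j → j < l → l < a + k → y j < max (y i) (y l)

theorem Valley.sub {y : ℕ → ℝ} {a k b m : ℕ} (h : Valley y a k) (h1 : a ≤ b)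
    (h2 : b + m ≤ a + k) : Valley y b m :=
  ⟨fun i j hi hij hj ↦ h.1 i j (h1.trans hi) hij (hj.trans_le h2),
    fun i j l hi hij hjl hl ↦ h.2 i j l (h1.trans hi) hij hjl (hl.trans_le h2)⟩

theorem Valley.max_at_end {y : ℕ → ℝ} {a k : ℕ} (h : Valley y a k) :
    (∀ i, a ≤ i → i < a + k → y i ≤ y a) ∨ (∀ i, a ≤ i → i < a + k → y i ≤ y (a + k - 1)) := by
  have key : ∀ i, a ≤ i → i < a + k → y i ≤ max (y a) (y (a + k - 1)) := by
    intro i hi hik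
    rcases hi.eq_or_lt with rfl | hi
    · exact le_max_left _ _
    rcases (show i ≤ a + k - 1 by omega).eq_or_lt with rfl | hik'
    · exact le_max_right _ _
    exact (h.2 a i (a + k - 1) le_rfl hi hik' (by omega)).le
  rcases le_total (y a) (y (a + k - 1)) with hle | hle
  · exact Or.inr fun i hi hik ↦ by simpa [max_eq_right hle] using key i hi hik
  · exact Or.inl fun i hi hik ↦ by simpa [max_eq_left hle] using key i hi hik

/-- A placement of the vertices of `A` on the positions `a, …, a + #A - 1` of a line such that no
two edges interleave and no edge passes over the position of `v`. -/
structure LinePlacement {V : Type*} (G : SimpleGraph V) (v : V) (A : Finset V) (a : ℕ)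
    (f : V → ℕ) : Prop where
  le : ∀ x ∈ A, a ≤ f x
  lt : ∀ x ∈ A, f x < a + A.card
  inj : ∀ x ∈ A, ∀ z ∈ A, f x = f z → x = z
  noncross : ∀ p ∈ A, ∀ q ∈ A, ∀ r ∈ A, ∀ s ∈ A, G.Adj p q → G.Adj r s →
    ¬ (f p < f r ∧ f r < f q ∧ f q < f s)
  exposed : ∀ p ∈ A, ∀ q ∈ A, G.Adj p q → ¬ (f p < f v ∧ f v < f q)

theorem LinePlacement.union {V : Type*} [DecidableEq V] {G : SimpleGraph V} {u w : V}
    {A B : Finset V} {a b c : ℕ} {f g : V → ℕ} (hf : LinePlacement G u A a f)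
    (hg : LinePlacement G w B b g) (hu : u ∈ A) (hw : w ∈ B) (hd : Disjoint A B)
    (hcross : ∀ p ∈ A, ∀ q ∈ B, G.Adj p q → p = u ∧ q = w)
    (hpos : (a = c ∧ b = c + A.card) ∨ (b = c ∧ a = c + B.card)) :
    LinePlacement G u (A ∪ B) c (fun x ↦ if x ∈ A then f x else g x) := by
  have hcard := card_union_of_disjoint hd
  have hB : ∀ x ∈ B, x ∉ A := fun x hx hx' ↦ Finset.disjoint_left.1 hd hx' hx
  have hcross' : ∀ p ∈ B, ∀ q ∈ A, G.Adj p q → p = w ∧ q = u :=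
    fun p hp q hq h ↦ (hcross q hq p hp h.symm).symm
  obtain ⟨f1, f2, f3, f4, f5⟩ := hf
  obtain ⟨g1, g2, g3, g4, g5⟩ := hg
  set F : V → ℕ := fun x ↦ if x ∈ A then f x else g x with hF
  have FA : ∀ x ∈ A, f x = F x := fun x hx ↦ by simp [hF, hx]
  have FB : ∀ x ∈ B, g x = F x := fun x hx ↦ by simp [hF, hB x hx]
  have rA : ∀ x ∈ A, a ≤ F x ∧ F x < a + A.card := fun x hx ↦ FA x hx ▸ ⟨f1 x hx, f2 x hx⟩
  have rB : ∀ x ∈ B, b ≤ F x ∧ F x < b + B.card := fun x hx ↦ FB x hx ▸ ⟨g1 x hx, g2 x hx⟩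
  have H : ∀ p ∈ A ∪ B, ∀ q ∈ A ∪ B, G.Adj p q →
      (p ∈ A ∧ q ∈ A ∧ ¬ (F p < F u ∧ F u < F q)) ∨
      (p ∈ B ∧ q ∈ B ∧ ¬ (F p < F w ∧ F w < F q)) ∨ (p = u ∧ q = w) ∨ (p = w ∧ q = u) := by
    intro p hp q hq hpq
    rcases mem_union.1 hp with h | h <;> rcases mem_union.1 hq with h' | h'
    · have := f5 p h q h' hpq
      rw [FA p h, FA q h', FA u hu] at this
      exact Or.inl ⟨h, h', this⟩
    · exact Or.inr (Or.inr (Or.inl (hcross p h q h' hpq)))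
    · exact Or.inr (Or.inr (Or.inr (hcross' p h q h' hpq)))
    · have := g5 p h q h' hpq
      rw [FB p h, FB q h', FB w hw] at this
      exact Or.inr (Or.inl ⟨h, h', this⟩)
  have ru := rA u hu
  have hwr := rB w hw
  constructor
  · intro x hx
    rcases mem_union.1 hx with h | h
    · have := rA x h; omega
    · have := rB x h; omega
  · intro x hx
    rcases mem_union.1 hx with h | h
    · have := rA x h; omega
    · have := rB x h; omega
  · intro x hx z hz hxz
    rcases mem_union.1 hx with h | h <;> rcases mem_union.1 hz with h' | h'
    · exact f3 x h z h' (by rw [FA x h, FA z h', hxz])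
    · have := rA x h; have := rB z h'; omega
    · have := rA z h'; have := rB x h; omega
    · exact g3 x h z h' (by rw [FB x h, FB z h', hxz])
  · intro p hp q hq r hr s hs hpq hrs
    rcases H p hp q hq hpq with ⟨h1, h2, h⟩ | ⟨h1, h2, h⟩ | ⟨rfl, rfl⟩ | ⟨rfl, rfl⟩ <;>
    rcases H r hr s hs hrs with ⟨h3, h4, h'⟩ | ⟨h3, h4, h'⟩ | ⟨rfl, rfl⟩ | ⟨rfl, rfl⟩
    · have := f4 p h1 q h2 r h3 s h4 hpq hrs
      rwa [FA p h1, FA q h2, FA r h3, FA s h4] at this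
    · have := rA p h1; have := rA q h2; have := rB r h3; have := rB s h4; omega
    · have := rA p h1; have := rA q h2; omega
    · have := rA p h1; have := rA q h2; omega
    · have := rB p h1; have := rB q h2; have := rA r h3; have := rA s h4; omega
    · have := g4 p h1 q h2 r h3 s h4 hpq hrs
      rwa [FB p h1, FB q h2, FB r h3, FB s h4] at this
    · have := rB p h1; have := rB q h2; omega
    · have := rB p h1; have := rB q h2; omega
    · have := rA r h3; have := rA s h4; omega
    · have := rB r h3; have := rB s h4; omega
    · omega
    · omega
    · have := rA r h3; have := rA s h4; omega
    · have := rB r h3; have := rB s h4; omega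
    · omega
    · omega
  · intro p hp q hq hpq
    rcases H p hp q hq hpq with ⟨h1, h2, h⟩ | ⟨h1, h2, h⟩ | ⟨rfl, rfl⟩ | ⟨rfl, rfl⟩
    · exact h
    · have := rB p h1; have := rB q h2; omega
    · omega
    · omega

theorem exists_linePlacement {V : Type*} [DecidableEq V] {Adj : V → V → Prop}
    (hsw : IsSwitch Adj) (y : ℕ → ℝ) {v : V} {A : Finset V}
    (hA : RootedBuild (SimpleGraph.fromRel Adj) v A) (a : ℕ) (hy : Valley y a A.card) :
    ∃ f : V → ℕ, LinePlacement (SimpleGraph.fromRel Adj) v A a f ∧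
      (∀ x ∈ A, ∀ z ∈ A, Adj x z → x ≠ z → y (f x) < y (f z)) ∧
      ((∀ x, ¬ Adj v x) → ∀ i, a ≤ i → i < a + A.card → y i ≤ y (f v)) := by
  induction hA generalizing a with
  | single v =>
    refine ⟨fun _ ↦ a, ⟨by simp, by simp, by simp, by simp, by simp⟩, ?_, ?_⟩
    · intro x hx z hz _ hxz
      rw [mem_singleton] at hx hz
      exact (hxz (hx.trans hz.symm)).elim
    · intro _ i h1 h2
      rw [card_singleton] at h2
      exact (congrArg y (show i = a by omega)).le
  | @glue u w A B hA hB hd huw hcross ihA ihB =>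
    have hu := hA.root_mem
    have hw := hB.root_mem
    have hcard := card_union_of_disjoint hd
    have hBA : ∀ x ∈ B, x ∉ A := fun x hx hx' ↦ Finset.disjoint_left.1 hd hx' hx
    have hApos := card_pos.2 ⟨u, hu⟩
    have hBpos := card_pos.2 ⟨w, hw⟩
    have main : ∀ b c, ((b = a ∧ c = a + A.card) ∨ (c = a ∧ b = a + B.card)) →
        ((∃ m, b ≤ m ∧ m < b + A.card ∧ ∀ i, a ≤ i → i < a + (A ∪ B).card → y i ≤ y m) ∧
          (∀ x, ¬ Adj u x) ∨
        (∃ m, c ≤ m ∧ m < c + B.card ∧ ∀ i, a ≤ i → i < a + (A ∪ B).card → y i ≤ y m) ∧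
          ¬ (∀ x, ¬ Adj u x)) →
        ∃ f : V → ℕ, LinePlacement (SimpleGraph.fromRel Adj) u (A ∪ B) a f ∧
          (∀ x ∈ A ∪ B, ∀ z ∈ A ∪ B, Adj x z → x ≠ z → y (f x) < y (f z)) ∧
          ((∀ x, ¬ Adj u x) → ∀ i, a ≤ i → i < a + (A ∪ B).card → y i ≤ y (f u)) := by
      intro b c hpos hmax
      obtain ⟨f, hf, hfy, hfm⟩ := ihA b (hy.sub (by omega) (by omega))
      obtain ⟨g, hg, hgy, hgm⟩ := ihB c (hy.sub (by omega) (by omega))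
      have f1 := hf.le u hu
      have f2 := hf.lt u hu
      have g1 := hg.le w hw
      have g2 := hg.lt w hw
      have hne : y (f u) ≠ y (g w) := by
        rcases lt_or_gt_of_ne (show f u ≠ g w by omega) with h | h
        · exact hy.1 _ _ (by omega) h (by omega)
        · exact (hy.1 _ _ (by omega) h (by omega)).symm
      rw [SimpleGraph.fromRel_adj] at huw
      refine ⟨_, hf.union hg hu hw hd hcross (by omega), ?_, ?_⟩
      · have hup : (Adj u w → y (f u) < y (g w)) ∧ (Adj w u → y (g w) < y (f u)) := by
          rcases hmax with ⟨⟨m, hm1, hm2, hm⟩, hs⟩ | ⟨⟨m, hm1, hm2, hm⟩, hs⟩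
          · refine ⟨fun h ↦ (hs w h).elim, fun _ ↦ lt_of_le_of_ne ?_ hne.symm⟩
            exact (hm _ (by omega) (by omega)).trans (hfm hs m hm1 hm2)
          · have hsrc := (hsw u).resolve_right hs
            have hws : ∀ x, ¬ Adj w x :=
              (hsw w).resolve_left fun h ↦ huw.2.elim (h u) (hsrc w)
            refine ⟨fun _ ↦ lt_of_le_of_ne ?_ hne, fun h ↦ (hsrc w h).elim⟩
            exact (hm _ (by omega) (by omega)).trans (hgm hws m hm1 hm2)
        intro x hx z hz hxz hxz'
        rcases mem_union.1 hx with h | h <;> rcases mem_union.1 hz with h' | h'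
        · simpa only [h, h', if_true] using hfy x h z h' hxz hxz'
        · obtain ⟨rfl, rfl⟩ := hcross x h z h' ((SimpleGraph.fromRel_adj _ _ _).2
            ⟨hxz', Or.inl hxz⟩)
          simpa only [h, hBA z h', if_true, if_false] using hup.1 hxz
        · obtain ⟨rfl, rfl⟩ := hcross z h' x h ((SimpleGraph.fromRel_adj _ _ _).2
            ⟨hxz'.symm, Or.inr hxz⟩)
          simpa only [h', hBA x h, if_true, if_false] using hup.2 hxz
        · simpa only [hBA x h, hBA z h', if_false] using hgy x h z h' hxz hxz'
      · intro hs i h1 h2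
        rcases hmax with ⟨⟨m, hm1, hm2, hm⟩, -⟩ | ⟨-, hs'⟩
        · simpa only [hu, if_true] using (hm i h1 h2).trans (hfm hs m hm1 hm2)
        · exact (hs' hs).elim
    by_cases hs : ∀ x, ¬ Adj u x
    · rcases hy.max_at_end with hm | hm
      · exact main a (a + A.card) (by omega) (Or.inl ⟨⟨a, by omega, by omega, hm⟩, hs⟩)
      · exact main (a + B.card) a (by omega) (Or.inl ⟨⟨_, by omega, by omega, hm⟩, hs⟩)
    · rcases hy.max_at_end with hm | hm
      · exact main (a + B.card) a (by omega) (Or.inr ⟨⟨a, by omega, by omega, hm⟩, hs⟩)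
      · exact main a (a + A.card) (by omega) (Or.inr ⟨⟨_, by omega, by omega, hm⟩, hs⟩)

theorem det2_pos_of_angle_lt {t p q : ℝ × ℝ} (hp : p.2 < t.2) (hq : q.2 < t.2)
    (h : (p.1 - t.1) / (t.2 - p.2) < (q.1 - t.1) / (t.2 - q.2)) :
    0 < det2 (p - t) (q - t) := by
  rw [div_lt_div_iff₀ (by linarith) (by linarith)] at h
  simp only [det2, Prod.fst_sub, Prod.snd_sub]
  nlinarith

theorem collinear_of_det2_eq_zero {t p q : ℝ × ℝ} (hp : p.2 ≠ t.2)
    (h : det2 (p - t) (q - t) = 0) : Collinear ℝ ({t, p, q} : Set (ℝ × ℝ)) := by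
  have hp' : p.2 - t.2 ≠ 0 := sub_ne_zero.2 hp
  refine (collinear_iff_of_mem (p₀ := t) (by simp)).2 ⟨p - t, ?_⟩
  simp only [det2, Prod.fst_sub, Prod.snd_sub] at h
  simp only [Set.mem_insert_iff, Set.mem_singleton_iff, vadd_eq_add, forall_eq_or_imp, forall_eq]
  refine ⟨⟨0, by simp⟩, ⟨1, by simp⟩, ⟨(q.2 - t.2) / (p.2 - t.2), ?_⟩⟩
  ext
  · simp only [Prod.fst_add, Prod.smul_fst, Prod.fst_sub, smul_eq_mul]
    field_simp
    linarith
  · simp only [Prod.snd_add, Prod.smul_snd, Prod.snd_sub, smul_eq_mul]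
    field_simp
    ring

/-- If `q` lies in the cone at `t` spanned by `p` and `r` but not beyond the segment from `p`
to `r`, then it lies in the triangle `t`, `p`, `r`. -/
theorem mem_convexHull_of_det2_nonpos {t p q r : ℝ × ℝ} (h1 : 0 < det2 (p - t) (q - t))
    (h2 : 0 < det2 (q - t) (r - t)) (h3 : 0 < det2 (p - t) (r - t))
    (h : det2 (q - p) (r - p) ≤ 0) : q ∈ convexHull ℝ ({t, p, r} : Set (ℝ × ℝ)) := by
  set D := det2 (p - t) (r - t) with hD
  have hq : q = (-det2 (q - p) (r - p) / D) • t + (det2 (q - t) (r - t) / D) • p +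
      (det2 (p - t) (q - t) / D) • r := by
    have hD0 := h3.ne'
    ext
    · simp only [Prod.fst_add, Prod.smul_fst, smul_eq_mul]
      field_simp
      simp only [hD, det2, Prod.fst_sub, Prod.snd_sub]
      ring
    · simp only [Prod.snd_add, Prod.smul_snd, smul_eq_mul]
      field_simp
      simp only [hD, det2, Prod.fst_sub, Prod.snd_sub]
      ring
  have hsum : -det2 (q - p) (r - p) / D + det2 (q - t) (r - t) / D +
      det2 (p - t) (q - t) / D = 1 := by
    have hD0 := h3.ne'
    field_simp
    simp only [hD, det2, Prod.fst_sub, Prod.snd_sub]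
    ring
  have hc := convex_convexHull ℝ ({t, p, r} : Set (ℝ × ℝ))
  have hs := subset_convexHull ℝ ({t, p, r} : Set (ℝ × ℝ))
  rw [hq]
  have := hc.sum_mem (t := Finset.univ) (w := ![-det2 (q - p) (r - p) / D,
    det2 (q - t) (r - t) / D, det2 (p - t) (q - t) / D]) (z := ![t, p, r])
    (by
      intro i _
      fin_cases i
      · exact div_nonneg (by linarith) h3.le
      · exact div_nonneg h2.le h3.le
      · exact div_nonneg h1.le h3.le)
    (by simpa [Fin.sum_univ_three] using hsum)
    (by
      intro i _
      fin_cases i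
      · exact hs (by simp)
      · exact hs (by simp)
      · exact hs (by simp))
  simpa [Fin.sum_univ_three] using this

theorem lt_max_of_det2_pos {t p q r : ℝ × ℝ} (hq : q.2 < t.2) (h1 : 0 < det2 (p - t) (q - t))
    (h2 : 0 < det2 (q - t) (r - t)) (h : 0 < det2 (q - p) (r - p)) : q.2 < max p.2 r.2 := by
  by_contra! hc
  have hp := (le_max_left _ _).trans hc
  have hr := (le_max_right _ _).trans hc
  have key : (t.2 - q.2) * det2 (q - p) (r - p) =
      (p.2 - q.2) * det2 (q - t) (r - t) + (r.2 - q.2) * det2 (p - t) (q - t) := by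
    simp only [det2, Prod.fst_sub, Prod.snd_sub]
    ring
  have e1 := mul_pos (sub_pos.2 hq) h
  have e2 := mul_nonneg (sub_nonneg.2 hp) h2.le
  have e3 := mul_nonneg (sub_nonneg.2 hr) h1.le
  linarith

/-- A convex point set can be enumerated counterclockwise, starting from its highest point; the
heights then form a valley. -/
theorem exists_ccw_enumeration {S : Finset (ℝ × ℝ)} (hS : ConvexPos S) {t : ℝ × ℝ}
    (ht : IsHighest S t) : ∃ P : ℕ → ℝ × ℝ,
      (∀ i < S.card, P i ∈ S) ∧ (∀ q ∈ S, ∃ i < S.card, P i = q) ∧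
      (∀ i j, i < j → j < S.card → P i ≠ P j) ∧
      (∀ i j k, i < j → j < k → k < S.card → 0 < det2 (P j - P i) (P k - P i)) ∧
      Valley (fun i ↦ (P i).2) 0 S.card := by
  classical
  obtain ⟨⟨hy, hcol⟩, hconv⟩ := hS
  have hlt : ∀ p ∈ S, p ≠ t → p.2 < t.2 :=
    fun p hp hpt ↦ lt_of_le_of_ne (ht.2 p hp) (hy p hp t ht.1 hpt)
  let key : ℝ × ℝ → WithBot ℝ :=
    fun p ↦ if p = t then ⊥ else (((p.1 - t.1) / (t.2 - p.2) : ℝ) : WithBot ℝ)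
  have keyt : ∀ p, p ≠ t → key p = (((p.1 - t.1) / (t.2 - p.2) : ℝ) : WithBot ℝ) :=
    fun p hp ↦ if_neg hp
  have key0 : key t = ⊥ := if_pos rfl
  have hne : ∀ {p q}, key p < key q → q ≠ t := by
    rintro p q h rfl
    rw [key0] at h
    exact not_lt_bot h
  have htri : ∀ p ∈ S, ∀ q ∈ S, p ≠ t → key p < key q → 0 < det2 (p - t) (q - t) := by
    intro p hp q hq hpt h
    have hqt := hne h
    rw [keyt p hpt, keyt q hqt, WithBot.coe_lt_coe] at h
    exact det2_pos_of_angle_lt (hlt p hp hpt) (hlt q hq hqt) h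
  have hinj : Set.InjOn key (S : Set (ℝ × ℝ)) := by
    intro p hp q hq h
    by_contra hpq
    by_cases hpt : p = t
    · subst hpt
      rw [key0, keyt q (Ne.symm hpq)] at h
      exact WithBot.bot_ne_coe h
    by_cases hqt : q = t
    · subst hqt
      rw [key0, keyt p hpq] at h
      exact WithBot.coe_ne_bot h
    rw [keyt p hpt, keyt q hqt, WithBot.coe_inj] at h
    have h1 := hlt p hp hpt
    have h2 := hlt q hq hqt
    refine hcol t ht.1 p hp q hq (Ne.symm hpt) (Ne.symm hqt) hpq
      (collinear_of_det2_eq_zero h1.ne ?_)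
    rw [div_eq_div_iff (by linarith) (by linarith)] at h
    simp only [det2, Prod.fst_sub, Prod.snd_sub]
    linarith
  have hccw : ∀ p ∈ S, ∀ q ∈ S, ∀ r ∈ S, key p < key q → key q < key r →
      0 < det2 (q - p) (r - p) := by
    intro p hp q hq r hr hpq hqr
    have hqt := hne hpq
    have hrt := hne hqr
    by_cases hpt : p = t
    · subst hpt
      exact htri q hq r hr hqt hqr
    by_contra! h
    refine hconv q hq (convexHull_mono ?_ (mem_convexHull_of_det2_nonpos
      (htri p hp q hq hpt hpq) (htri q hq r hr hqt hqr) (htri p hp r hr hpt (hpq.trans hqr)) h))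
    intro x hx
    rw [mem_coe, mem_erase]
    rcases hx with rfl | rfl | rfl
    · exact ⟨hqt.symm, ht.1⟩
    · exact ⟨fun h ↦ (h ▸ hpq).false, hp⟩
    · exact ⟨fun h ↦ (h ▸ hqr).false, hr⟩
  have hcard : (S.image key).card = S.card := card_image_of_injOn hinj
  let e := (S.image key).orderEmbOfFin hcard
  have hex : ∀ i : ℕ, ∃ p, ∀ h : i < S.card, p ∈ S ∧ key p = e ⟨i, h⟩ := by
    intro i
    by_cases h : i < S.card
    · obtain ⟨p, hp, hpe⟩ := mem_image.1 ((S.image key).orderEmbOfFin_mem hcard ⟨i, h⟩)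
      exact ⟨p, fun _ ↦ ⟨hp, hpe⟩⟩
    · exact ⟨0, fun h' ↦ (h h').elim⟩
  choose P hP using hex
  have hmono : ∀ i j, i < j → j < S.card → key (P i) < key (P j) := by
    intro i j hij hj
    rw [(hP i (hij.trans hj)).2, (hP j hj).2]
    exact e.strictMono hij
  have hPne : ∀ i j, i < j → j < S.card → P i ≠ P j :=
    fun i j hij hj h ↦ (h ▸ hmono i j hij hj).false
  refine ⟨P, fun i hi ↦ (hP i hi).1, ?_, hPne, ?_, ?_, ?_⟩
  · intro q hq
    have : key q ∈ Set.range e := by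
      rw [(S.image key).range_orderEmbOfFin hcard]
      exact mem_coe.2 (mem_image_of_mem key hq)
    obtain ⟨i, hi⟩ := this
    exact ⟨i, i.2, hinj (hP i i.2).1 hq ((hP i i.2).2.trans hi)⟩
  · intro i j k hij hjk hk
    have hj := hjk.trans hk
    exact hccw _ (hP i (hij.trans hj)).1 _ (hP j hj).1 _ (hP k hk).1 (hmono i j hij hj)
      (hmono j k hjk hk)
  · intro i j _ hij hj
    rw [zero_add] at hj
    exact hy _ (hP i (hij.trans hj)).1 _ (hP j hj).1 (hPne i j hij hj)
  · intro i j k _ hij hjk hk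
    rw [zero_add] at hk
    have hj := hjk.trans hk
    have hi := hij.trans hj
    have m1 := hmono i j hij hj
    have m2 := hmono j k hjk hk
    have hjt := hlt _ (hP j hj).1 (hne m1)
    by_cases hit : P i = t
    · exact lt_max_of_lt_left (by simpa only [hit] using hjt)
    · exact lt_max_of_det2_pos hjt (htri _ (hP i hi).1 _ (hP j hj).1 hit m1)
        (htri _ (hP j hj).1 _ (hP k hk).1 (hne m1) m2)
        (hccw _ (hP i hi).1 _ (hP j hj).1 _ (hP k hk).1 m1 m2)

/-- A segment `CD` on one side of the line `AB` meets the segment `AB` only in a common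
endpoint. -/
theorem mem_endpoints_of_same_side {A B C D p : ℝ × ℝ} (hC : 0 ≤ det2 (B - A) (C - A))
    (hD : 0 ≤ det2 (B - A) (D - A)) (hC0 : det2 (B - A) (C - A) = 0 → C = A ∨ C = B)
    (hD0 : det2 (B - A) (D - A) = 0 → D = A ∨ D = B)
    (hCD : ¬ (det2 (B - A) (C - A) = 0 ∧ det2 (B - A) (D - A) = 0))
    (h1 : p ∈ segment ℝ A B) (h2 : p ∈ segment ℝ C D) :
    p ∈ ({A, B} : Set (ℝ × ℝ)) ∧ p ∈ ({C, D} : Set (ℝ × ℝ)) := by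
  obtain ⟨s, s', hs, hs', hss, rfl⟩ := h1
  obtain ⟨r, r', hr, hr', hrr, he⟩ := h2
  have hz : r * det2 (B - A) (C - A) + r' * det2 (B - A) (D - A) = 0 := by
    have e1 := congrArg Prod.fst he
    have e2 := congrArg Prod.snd he
    simp only [Prod.fst_add, Prod.snd_add, Prod.smul_fst, Prod.smul_snd, smul_eq_mul] at e1 e2
    obtain rfl : s = 1 - s' := by linarith
    obtain rfl : r = 1 - r' := by linarith
    simp only [det2, Prod.fst_sub, Prod.snd_sub]
    linear_combination (B.1 - A.1) * e2 - (B.2 - A.2) * e1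
  have z1 := mul_nonneg hr hC
  have z2 := mul_nonneg hr' hD
  have w1 : r = 0 ∨ det2 (B - A) (C - A) = 0 := mul_eq_zero.1 (by linarith)
  have w2 : r' = 0 ∨ det2 (B - A) (D - A) = 0 := mul_eq_zero.1 (by linarith)
  rw [← he]
  rcases w1 with h | h
  · obtain rfl : r' = 1 := by linarith
    have := hD0 (w2.resolve_left one_ne_zero)
    subst h
    simpa using this
  · obtain rfl := w2.resolve_right fun h' ↦ hCD ⟨h, h'⟩
    obtain rfl : r = 1 := by linarith
    simpa using hC0 h

/-- Non-interleaving chords of a counterclockwise convex polygon meet only in common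
endpoints. -/
theorem mem_endpoints_of_not_interleave {P : ℕ → ℝ × ℝ} {n : ℕ}
    (hP : ∀ i j k, i < j → j < k → k < n → 0 < det2 (P j - P i) (P k - P i))
    {i j k l : ℕ} (hij : i < j) (hkl : k < l) (hj : j < n) (hl : l < n)
    (hne : ¬ (i = k ∧ j = l)) (h1 : ¬ (i < k ∧ k < j ∧ j < l)) (h2 : ¬ (k < i ∧ i < l ∧ l < j))
    {p : ℝ × ℝ} (hp1 : p ∈ segment ℝ (P i) (P j)) (hp2 : p ∈ segment ℝ (P k) (P l)) :
    p ∈ ({P i, P j} : Set (ℝ × ℝ)) ∧ p ∈ ({P k, P l} : Set (ℝ × ℝ)) := by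
  have hswap : ∀ A B C : ℝ × ℝ, det2 (A - B) (C - B) = - det2 (B - A) (C - A) := by
    intro A B C
    simp only [det2, Prod.fst_sub, Prod.snd_sub]
    ring
  have hpos : ∀ m < n, m < i ∨ j < m → 0 < det2 (P j - P i) (P m - P i) := by
    rintro m hm (h | h)
    · have := hP m i j h hij hj
      simp only [det2, Prod.fst_sub, Prod.snd_sub] at this ⊢
      linarith
    · exact hP i j m hij h hm
  have hneg : ∀ m, i < m → m < j → det2 (P j - P i) (P m - P i) < 0 := by
    intro m h h'
    have := hP i m j h h' hj
    simp only [det2, Prod.fst_sub, Prod.snd_sub] at this ⊢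
    linarith
  have hi0 : det2 (P j - P i) (P i - P i) = 0 := by simp [det2]
  have hj0 : det2 (P j - P i) (P j - P i) = 0 := by simp only [det2]; ring
  have hzero : ∀ m < n, det2 (P j - P i) (P m - P i) = 0 → m = i ∨ m = j := by
    intro m hm h
    by_contra! hc
    rcases lt_or_gt_of_ne hc.1 with h' | h'
    · exact (hpos m hm (Or.inl h')).ne' h
    rcases lt_or_gt_of_ne hc.2 with h'' | h''
    · exact (hneg m h' h'').ne h
    · exact (hpos m hm (Or.inr h'')).ne' h
  have hk := hkl.trans hl
  have hboth : ¬ (det2 (P j - P i) (P k - P i) = 0 ∧ det2 (P j - P i) (P l - P i) = 0) := by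
    rintro ⟨a, b⟩
    have := hzero k hk a
    have := hzero l hl b
    omega
  by_cases hin : i ≤ k ∧ l ≤ j
  · have hle : ∀ m, i ≤ m → m ≤ j → det2 (P j - P i) (P m - P i) ≤ 0 := by
      intro m h h'
      rcases h.eq_or_lt with rfl | h
      · exact hi0.le
      rcases h'.eq_or_lt with rfl | h'
      · exact hj0.le
      exact (hneg m h h').le
    have := mem_endpoints_of_same_side (A := P j) (B := P i) (C := P k) (D := P l) (p := p)
      (by rw [hswap]; linarith [hle k hin.1 (by omega)])
      (by rw [hswap]; linarith [hle l (by omega) hin.2])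
      (fun h ↦ by
        rw [hswap, neg_eq_zero] at h
        exact (hzero k hk h).symm.imp (congrArg P) (congrArg P))
      (fun h ↦ by
        rw [hswap, neg_eq_zero] at h
        exact (hzero l hl h).symm.imp (congrArg P) (congrArg P))
      (by rwa [hswap _ _ (P k), hswap _ _ (P l), neg_eq_zero, neg_eq_zero])
      (by rwa [segment_symm]) hp2
    rwa [Set.pair_comm (P i)]
  · have hge : ∀ m < n, m ≤ i ∨ j ≤ m → 0 ≤ det2 (P j - P i) (P m - P i) := by
      rintro m hm (h | h)
      · rcases h.eq_or_lt with rfl | h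
        · exact hi0.ge
        · exact (hpos m hm (Or.inl h)).le
      · rcases h.eq_or_lt with rfl | h
        · exact hj0.ge
        · exact (hpos m hm (Or.inr h)).le
    exact mem_endpoints_of_same_side (hge k hk (by omega)) (hge l hl (by omega))
      (fun h ↦ (hzero k hk h).imp (congrArg P) (congrArg P))
      (fun h ↦ (hzero l hl h).imp (congrArg P) (congrArg P)) hboth hp1 hp2

theorem switch_tree_UPSE_convex_sink {V : Type} [Fintype V] (Adj : V → V → Prop)
    (hT : IsDirTree Adj) (hsw : IsSwitch Adj)
    (r : V) (hr : ∀ u, ¬ Adj r u)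
    (S : Finset (ℝ × ℝ)) (hS : ConvexPos S) (hcard : S.card = Fintype.card V)
    (t : ℝ × ℝ) (ht : IsHighest S t) :
    ∃ f : V → ℝ × ℝ, UPSE Adj S f ∧ f r = t := by
  classical
  obtain ⟨hasym, hirr, htree⟩ := hT
  have hne : ∀ {u v}, Adj u v → u ≠ v := by
    rintro u v h rfl
    exact hirr u h
  have hbuild := rootedBuild_reachable _ htree.isAcyclic r
  rw [filter_true_of_mem fun x _ ↦ htree.connected.preconnected r x] at hbuild
  obtain ⟨P, hPS, hPsurj, hPne, hPccw, hval⟩ := exists_ccw_enumeration hS ht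
  rw [hcard, ← card_univ] at *
  obtain ⟨f, hf, hup, hmax⟩ := exists_linePlacement hsw _ hbuild 0 hval
  have hlt : ∀ x, f x < (univ : Finset V).card := fun x ↦ by simpa using hf.lt x (mem_univ x)
  have hfi : ∀ x z, f x = f z → x = z := fun x z ↦ hf.inj x (mem_univ x) z (mem_univ z)
  refine ⟨fun x ↦ P (f x), ⟨?_, fun v ↦ hPS _ (hlt v), ?_, ?_⟩, ?_⟩
  · intro x z h
    by_contra hxz
    rcases lt_or_gt_of_ne fun h ↦ hxz (hfi x z h) with h' | h'
    · exact hPne _ _ h' (hlt z) h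
    · exact hPne _ _ h' (hlt x) h.symm
  · exact fun u v h ↦ hup u (mem_univ u) v (mem_univ v) h (hne h)
  · have hadj : ∀ {u v}, Adj u v ∨ Adj v u → (SimpleGraph.fromRel Adj).Adj u v := fun h ↦
      (SimpleGraph.fromRel_adj _ _ _).2 ⟨h.elim hne fun h ↦ (hne h).symm, h⟩
    have main : ∀ a b c d, Adj a b ∨ Adj b a → Adj c d ∨ Adj d c → f a < f b → f c < f d →
        ¬ (a = c ∧ b = d) → ∀ p, p ∈ segment ℝ (P (f a)) (P (f b)) →
        p ∈ segment ℝ (P (f c)) (P (f d)) →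
        p ∈ ({P (f a), P (f b)} : Set (ℝ × ℝ)) ∧ p ∈ ({P (f c), P (f d)} : Set (ℝ × ℝ)) := by
      intro a b c d hab hcd h1 h2 hn p hp1 hp2
      refine mem_endpoints_of_not_interleave hPccw h1 h2 (hlt b) (hlt d)
        (fun h ↦ hn ⟨hfi _ _ h.1, hfi _ _ h.2⟩) ?_ ?_ hp1 hp2
      · exact hf.noncross a (mem_univ a) b (mem_univ b) c (mem_univ c) d (mem_univ d)
          (hadj hab) (hadj hcd)
      · exact hf.noncross c (mem_univ c) d (mem_univ d) a (mem_univ a) b (mem_univ b)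
          (hadj hcd) (hadj hab)
    intro a b c d hab hcd hn p hp1 hp2
    have hn1 : ¬ (a = c ∧ b = d) := fun h ↦ hn (Prod.ext h.1 h.2)
    have hn2 : ¬ (a = d ∧ b = c) := by
      rintro ⟨rfl, rfl⟩
      exact hasym _ _ hab hcd
    rcases lt_or_gt_of_ne fun h ↦ hne hab (hfi a b h) with h1 | h1 <;>
    rcases lt_or_gt_of_ne fun h ↦ hne hcd (hfi c d h) with h2 | h2
    · exact main a b c d (Or.inl hab) (Or.inl hcd) h1 h2 hn1 p hp1 hp2
    · rw [segment_symm] at hp2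
      rw [Set.pair_comm (P (f c))]
      exact main a b d c (Or.inl hab) (Or.inr hcd) h1 h2 hn2 p hp1 hp2
    · rw [segment_symm] at hp1
      rw [Set.pair_comm (P (f a))]
      exact main b a c d (Or.inr hab) (Or.inl hcd) h1 h2 (fun h ↦ hn2 h.symm) p hp1 hp2
    · rw [segment_symm] at hp1 hp2
      rw [Set.pair_comm (P (f a)), Set.pair_comm (P (f c))]
      exact main b a d c (Or.inr hab) (Or.inr hcd) h1 h2 (fun h ↦ hn1 h.symm) p hp1 hp2
  · obtain ⟨i, hi, rfl⟩ := hPsurj t ht.1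
    by_contra h
    exact hS.1.1 _ (hPS _ (hlt r)) _ ht.1 h
      (le_antisymm (ht.2 _ (hPS _ (hlt r))) (hmax hr i (Nat.zero_le i) (by simpa using hi)))
end
end

section
/- For every odd integer n ≥ 5, there exists a directed tree T with 3n+1 vertices and a convex point set S of size 3n+1 such that T admits no upward planar straight-line embedding into S. -/
open Finset

noncomputable section

/-! ### Points on the parabola -/

/-- The point of the parabola `y = x ^ 2` with abscissa `x`. -/
def parabolaPoint (x : ℝ) : ℝ × ℝ := (x, x ^ 2)

lemma mem_segment_parabolaPoint {u v x : ℝ} (huv : u < v) (hu : u ≤ x) (hv : x ≤ v) :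
    (x, (u + v) * x - u * v) ∈ segment ℝ (parabolaPoint u) (parabolaPoint v) := by
  have h : 0 < v - u := sub_pos.2 huv
  refine ⟨(v - x) / (v - u), (x - u) / (v - u), div_nonneg (by linarith) h.le,
    div_nonneg (by linarith) h.le, ?_, ?_⟩
  · field_simp
    ring
  · ext
    · simp only [parabolaPoint, Prod.fst_add, Prod.smul_fst, smul_eq_mul]
      field_simp
      ring
    · simp only [parabolaPoint, Prod.snd_add, Prod.smul_snd, smul_eq_mul]
      field_simp
      ring

/-- Chords of the parabola with interleaving endpoints intersect. -/
lemma exists_mem_segment_inter_segment {u w v z : ℝ} (h₁ : u < w) (h₂ : w < v) (h₃ : v < z) :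
    ∃ p, p ∈ segment ℝ (parabolaPoint u) (parabolaPoint v) ∧
      p ∈ segment ℝ (parabolaPoint w) (parabolaPoint z) := by
  have hd : 0 < w + z - u - v := by linarith
  set x := (w * z - u * v) / (w + z - u - v) with hx
  have hx' : x * (w + z - u - v) = w * z - u * v := div_mul_cancel₀ _ hd.ne'
  have hwx : w ≤ x := by
    rw [hx, le_div_iff₀ hd]
    nlinarith [mul_pos (sub_pos.2 h₁) (sub_pos.2 h₂)]
  have hxv : x ≤ v := by
    rw [hx, div_le_iff₀ hd]
    nlinarith [mul_pos (sub_pos.2 h₂) (sub_pos.2 h₃)]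
  refine ⟨(x, (u + v) * x - u * v),
    mem_segment_parabolaPoint (h₁.trans h₂) (h₁.le.trans hwx) hxv, ?_⟩
  have hy : (u + v) * x - u * v = (w + z) * x - w * z := by linarith
  rw [hy]
  exact mem_segment_parabolaPoint (h₂.trans h₃) hwx (hxv.trans h₃.le)

lemma not_collinear_parabolaPoint {a b c : ℝ} (hab : a ≠ b) (hac : a ≠ c) (hbc : b ≠ c) :
    ¬ Collinear ℝ ({parabolaPoint a, parabolaPoint b, parabolaPoint c} : Set (ℝ × ℝ)) := by
  intro h
  obtain ⟨v, hv⟩ := (collinear_iff_of_mem (p₀ := parabolaPoint a) (by simp)).1 h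
  obtain ⟨r, hr⟩ := hv (parabolaPoint b) (by simp)
  obtain ⟨s, hs⟩ := hv (parabolaPoint c) (by simp)
  simp only [parabolaPoint, vadd_eq_add, Prod.ext_iff, Prod.fst_add, Prod.snd_add,
    Prod.smul_fst, Prod.smul_snd, smul_eq_mul] at hr hs
  have hprod : (b - a) * (c - a) * (c - b) = 0 := by
    have hr₁ : b - a = r * v.1 := by linarith [hr.1]
    have hs₁ : c - a = s * v.1 := by linarith [hs.1]
    have hr₂ : b ^ 2 - a ^ 2 = r * v.2 := by linarith [hr.2]
    have hs₂ : c ^ 2 - a ^ 2 = s * v.2 := by linarith [hs.2]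
    calc (b - a) * (c - a) * (c - b) = (b - a) * (c ^ 2 - a ^ 2) - (c - a) * (b ^ 2 - a ^ 2) := by
          ring
      _ = 0 := by rw [hr₁, hs₁, hr₂, hs₂]; ring
  simp only [mul_eq_zero, sub_eq_zero] at hprod
  rcases hprod with (h | h) | h
  · exact hab h.symm
  · exact hac h.symm
  · exact hbc h.symm

/-- The tangent at a point of the parabola separates it from all other points. -/
lemma parabolaPoint_notMem_convexHull {x : ℝ} {s : Set (ℝ × ℝ)}
    (hs : ∀ p ∈ s, ∃ y, y ≠ x ∧ p = parabolaPoint y) : parabolaPoint x ∉ convexHull ℝ s := by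
  have hconv : Convex ℝ {p : ℝ × ℝ | 0 < p.2 - 2 * x * p.1 + x ^ 2} := by
    intro p hp q hq a b ha hb hab
    simp only [Set.mem_ofPred_eq, Prod.snd_add, Prod.fst_add, Prod.smul_fst, Prod.smul_snd,
      smul_eq_mul] at hp hq ⊢
    have key : a * p.2 + b * q.2 - 2 * x * (a * p.1 + b * q.1) + x ^ 2 =
        a * (p.2 - 2 * x * p.1 + x ^ 2) + b * (q.2 - 2 * x * q.1 + x ^ 2) := by
      linear_combination (-(x ^ 2)) * hab
    rw [key]
    rcases ha.eq_or_lt with rfl | ha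
    · have : b = 1 := by linarith
      subst this
      linarith
    · exact add_pos_of_pos_of_nonneg (mul_pos ha hp) (mul_nonneg hb hq.le)
  intro hx
  have hsub : s ⊆ {p : ℝ × ℝ | 0 < p.2 - 2 * x * p.1 + x ^ 2} := by
    intro p hp
    obtain ⟨y, hy, rfl⟩ := hs p hp
    have : 0 < (y - x) ^ 2 := by
      have := sub_ne_zero.2 hy
      positivity
    simp only [parabolaPoint, Set.mem_ofPred_eq]
    linarith
  have := convexHull_min hsub hconv hx
  simp only [parabolaPoint, Set.mem_ofPred_eq] at this
  linarith

/-- The odd abscissae `4 i + 1` have pairwise distinct absolute values. -/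
def gridPoint : ℤ ↪ ℝ × ℝ where
  toFun i := parabolaPoint (4 * i + 1)
  inj' i j h := by
    have := congrArg Prod.fst h
    simp only [parabolaPoint] at this
    have h' : (i : ℝ) = j := by linarith
    exact_mod_cast h'

lemma gridPoint_apply (i : ℤ) : gridPoint i = parabolaPoint (4 * i + 1) := rfl

lemma gridPoint_snd_lt_iff (i j : ℤ) :
    (gridPoint i).2 < (gridPoint j).2 ↔ |4 * i + 1| < |4 * j + 1| := by
  simp only [gridPoint_apply, parabolaPoint, ← sq_lt_sq]
  exact_mod_cast Iff.rfl

lemma convexPos_map_gridPoint (s : Finset ℤ) : ConvexPos (s.map gridPoint) := by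
  refine ⟨⟨?_, ?_⟩, ?_⟩
  · intro p hp q hq hpq h
    obtain ⟨i, -, rfl⟩ := Finset.mem_map.1 hp
    obtain ⟨j, -, rfl⟩ := Finset.mem_map.1 hq
    have h₁ := (gridPoint_snd_lt_iff i j).not.1 h.not_lt
    have h₂ := (gridPoint_snd_lt_iff j i).not.1 h.not_gt
    apply hpq
    congr 1
    rcases abs_cases (4 * i + 1) with h | h <;> rcases abs_cases (4 * j + 1) with h' | h' <;> omega
  · intro p hp q hq r hr hpq hpr hqr
    obtain ⟨i, -, rfl⟩ := Finset.mem_map.1 hp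
    obtain ⟨j, -, rfl⟩ := Finset.mem_map.1 hq
    obtain ⟨l, -, rfl⟩ := Finset.mem_map.1 hr
    exact not_collinear_parabolaPoint (fun h => hpq (congrArg parabolaPoint h))
      (fun h => hpr (congrArg parabolaPoint h)) (fun h => hqr (congrArg parabolaPoint h))
  · intro p hp
    obtain ⟨i, -, rfl⟩ := Finset.mem_map.1 hp
    refine parabolaPoint_notMem_convexHull fun q hq => ?_
    obtain ⟨hne, hq⟩ := Finset.mem_erase.1 (Finset.mem_coe.1 hq)
    obtain ⟨j, -, rfl⟩ := Finset.mem_map.1 hq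
    exact ⟨_, fun h => hne (congrArg parabolaPoint h), rfl⟩

/-! ### Strict betweenness and crossing connected sets -/

/-- `b` lies strictly between `a` and `c`, in either order. -/
def StrictBtw (a b c : ℤ) : Prop := (a < b ∧ b < c) ∨ (c < b ∧ b < a)

lemma exists_mem_segment_of_strictBtw {a b c d : ℤ} (hb : StrictBtw a b c)
    (hd : ¬ StrictBtw a d c) (hda : d ≠ a) (hdc : d ≠ c) :
    ∃ p, p ∈ segment ℝ (gridPoint a) (gridPoint c) ∧
      p ∈ segment ℝ (gridPoint b) (gridPoint d) := by
  have cast {i j : ℤ} (h : i < j) : (4 * i + 1 : ℝ) < 4 * j + 1 := by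
    have : (i : ℝ) < j := by exact_mod_cast h
    linarith
  unfold StrictBtw at hb hd
  simp only [gridPoint_apply]
  rcases hb with ⟨h₁, h₂⟩ | ⟨h₁, h₂⟩
  · rcases lt_or_gt_of_ne hda with h | h
    · obtain ⟨p, hp, hp'⟩ := exists_mem_segment_inter_segment (cast h) (cast h₁) (cast h₂)
      exact ⟨p, hp', by rwa [segment_symm]⟩
    · have h₃ : c < d := by omega
      exact exists_mem_segment_inter_segment (cast h₁) (cast h₂) (cast h₃)
  · rcases lt_or_gt_of_ne hdc with h | h
    · obtain ⟨p, hp, hp'⟩ := exists_mem_segment_inter_segment (cast h) (cast h₁) (cast h₂)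
      exact ⟨p, by rwa [segment_symm], by rwa [segment_symm]⟩
    · have h₃ : a < d := by omega
      obtain ⟨p, hp, hp'⟩ := exists_mem_segment_inter_segment (cast h₁) (cast h₂) (cast h₃)
      exact ⟨p, by rwa [segment_symm], hp'⟩

/-- In the tree on `ℕ` where the parent of `v` is `v - 3`, the set `A` is a subtree with
topmost vertex `ρ`. -/
def IsSubtree (A : ℕ → Prop) (ρ : ℕ) : Prop :=
  ∀ v, A v → v ≠ ρ → 1 ≤ v ∧ A (v - 3)

lemma IsSubtree.exists_edge_of_root {A : ℕ → Prop} {ρ : ℕ} (hA : IsSubtree A ρ) (P : ℕ → Prop)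
    (v : ℕ) (hv : A v) (h : ¬ (P v ↔ P ρ)) : ∃ u, A u ∧ u ≠ ρ ∧ ¬ (P u ↔ P (u - 3)) := by
  induction v using Nat.strong_induction_on with
  | _ v ih =>
    have hne : v ≠ ρ := by rintro rfl; exact h Iff.rfl
    obtain ⟨h₁, h₂⟩ := hA v hv hne
    by_cases hP : P v ↔ P (v - 3)
    · exact ih (v - 3) (by omega) h₂ (by rwa [← hP])
    · exact ⟨v, hv, hne, hP⟩

lemma IsSubtree.exists_edge {A : ℕ → Prop} {ρ : ℕ} (hA : IsSubtree A ρ) (P : ℕ → Prop)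
    {v w : ℕ} (hv : A v) (hw : A w) (h : ¬ (P v ↔ P w)) :
    ∃ u, 1 ≤ u ∧ A u ∧ A (u - 3) ∧ ¬ (P u ↔ P (u - 3)) := by
  obtain ⟨u, hu, hne, hP⟩ : ∃ u, A u ∧ u ≠ ρ ∧ ¬ (P u ↔ P (u - 3)) := by
    by_cases hvρ : P v ↔ P ρ
    · exact hA.exists_edge_of_root P w hw (by tauto)
    · exact hA.exists_edge_of_root P v hv hvρ
  exact ⟨u, (hA u hu hne).1, hu, (hA u hu hne).2, hP⟩

/-- A placement of the vertices `0, …, N - 1` of the tree at integer positions of the parabola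
without crossing edges. -/
structure Placement (N : ℕ) (I : ℕ → ℤ) : Prop where
  inj : ∀ u < N, ∀ v < N, I u = I v → u = v
  noncrossing : ∀ u < N, ∀ v < N, 1 ≤ u → 1 ≤ v → u ≠ v → u - 3 ≠ v - 3 → u ≠ v - 3 → v ≠ u - 3 →
    (StrictBtw (I u) (I v) (I (u - 3)) ↔ StrictBtw (I u) (I (v - 3)) (I (u - 3)))

/-- Disjoint subtrees do not interleave. -/
lemma Placement.not_interleave {N : ℕ} {I : ℕ → ℤ} (hI : Placement N I) {A B : ℕ → Prop} {ρ σ : ℕ}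
    (hA : IsSubtree A ρ) (hB : IsSubtree B σ) (hAN : ∀ v, A v → v < N) (hBN : ∀ v, B v → v < N)
    (hAB : ∀ v, A v → ¬ B v) {p p' q q' : ℕ} (hp : A p) (hp' : A p') (hq : B q) (hq' : B q')
    (h : StrictBtw (I p) (I q) (I p')) : StrictBtw (I p) (I q') (I p') := by
  by_contra h'
  have ne {u v : ℕ} (hu : A u) (hv : B v) : I u ≠ I v := fun e =>
    hAB u hu (hI.inj u (hAN u hu) v (hBN v hv) e ▸ hv)
  have h₁ := ne hp hq
  have h₂ := ne hp' hq
  have h₃ := ne hp hq'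
  have h₄ := ne hp' hq'
  obtain ⟨u, hu, hAu, hAu', hPu⟩ := hA.exists_edge (fun u => StrictBtw (I q) (I u) (I q')) hp hp'
    (by unfold StrictBtw at *; omega)
  have h₁ := ne hAu hq
  have h₂ := ne hAu' hq
  have h₃ := ne hAu hq'
  have h₄ := ne hAu' hq'
  obtain ⟨w, hw, hBw, hBw', hPw⟩ := hB.exists_edge
    (fun w => StrictBtw (I u) (I w) (I (u - 3))) hq hq' (by unfold StrictBtw at *; omega)
  exact hPw (hI.noncrossing u (hAN u hAu) w (hBN w hBw) hu hw
    (fun e => hAB u hAu (e ▸ hBw)) (fun e => hAB _ hAu' (e ▸ hBw'))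
    (fun e => hAB u hAu (e ▸ hBw')) (fun e => hAB _ hAu' (e ▸ hBw)))

/-! ### The three branches -/

/-- The branch of length `n` whose topmost vertex is `c`, for `c = 1, 2, 3`. -/
def branch (n c : ℕ) : Finset ℕ := (Finset.range n).image fun i => 3 * i + c

lemma card_branch (n c : ℕ) : (branch n c).card = n := by
  rw [branch, Finset.card_image_of_injective _ (fun i j h => by simpa using h), Finset.card_range]

lemma mem_branch {n c v : ℕ} (h1 : 1 ≤ c) (h3 : c ≤ 3) :
    v ∈ branch n c ↔ v < 3 * n + 1 ∧ c ≤ v ∧ v % 3 = c % 3 := by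
  simp only [branch, Finset.mem_image, Finset.mem_range]
  constructor
  · rintro ⟨i, hi, rfl⟩
    omega
  · rintro ⟨h, h', h''⟩
    exact ⟨(v - c) / 3, by omega, by omega⟩

lemma isSubtree_branch {n c : ℕ} (h1 : 1 ≤ c) (h3 : c ≤ 3) : IsSubtree (· ∈ branch n c) c := by
  intro v hv hne
  simp only [mem_branch h1 h3] at hv ⊢
  omega

lemma exists_other_branches (c : ℕ) :
    ∃ d e : ℕ, 1 ≤ d ∧ d ≤ 3 ∧ 1 ≤ e ∧ e ≤ 3 ∧ d ≠ c ∧ e ≠ c ∧ d ≠ e := by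
  by_cases h₁ : c = 1
  · exact ⟨2, 3, by omega⟩
  by_cases h₂ : c = 2
  · exact ⟨1, 3, by omega⟩
  · exact ⟨1, 2, by omega⟩

/-- No placement at the positions `-K, …, K + 1` with `2 * K + 2 = 3 * n + 1` makes the edges
between `v` and `v - 3` upward for `v ≤ 6` and downward for `7 ≤ v`. -/
lemma Placement.false_of_upward {n K : ℕ} (hn : 5 ≤ n) (hK : 2 * K + 2 = 3 * n + 1) {I : ℕ → ℤ}
    (hI : Placement (3 * n + 1) I)
    (hrange : ∀ v < 3 * n + 1, -(K : ℤ) ≤ I v ∧ I v ≤ K + 1)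
    (hsurj : ∀ i : ℤ, -(K : ℤ) ≤ i → i ≤ K + 1 → ∃ v < 3 * n + 1, I v = i)
    (hup : ∀ v < 3 * n + 1, 1 ≤ v → v ≤ 6 → |4 * I (v - 3) + 1| < |4 * I v + 1|)
    (hdown : ∀ v < 3 * n + 1, 7 ≤ v → |4 * I v + 1| < |4 * I (v - 3) + 1|) : False := by
  have hinj := hI.inj
  obtain ⟨b, hbN, hb⟩ := hsurj 0 (by omega) (by omega)
  obtain ⟨t, htN, ht⟩ := hsurj (K + 1) (by omega) (by omega)
  have abs_le_top (v : ℕ) (hv : v < 3 * n + 1) : |4 * I v + 1| ≤ 4 * K + 5 := by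
    have := hrange v hv
    rw [abs_le]
    omega
  have habst : |4 * I t + 1| = 4 * K + 5 := by
    rw [ht, abs_of_nonneg (by omega)]
    ring
  have ht46 : 4 ≤ t ∧ t ≤ 6 := by
    by_contra hcon
    have : t ≤ 3 ∨ 7 ≤ t := by omega
    rcases this with h | h
    · have h₁ := hup (if t = 0 then 1 else t + 3) (by split_ifs <;> omega) (by split_ifs <;> omega)
        (by split_ifs <;> omega)
      have h₂ := abs_le_top (if t = 0 then 1 else t + 3) (by split_ifs <;> omega)
      have : (if t = 0 then 1 else t + 3) - 3 = t := by split_ifs <;> omega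
      rw [this] at h₁
      omega
    · have h₁ := hdown t htN h
      have h₂ := abs_le_top (t - 3) (by omega)
      omega
  have hb07 : b = 0 ∨ 7 ≤ b := by
    by_contra hcon
    have h₁ := hup b hbN (by omega) (by omega)
    rw [hb] at h₁
    rcases abs_cases (4 * I (b - 3) + 1) with h | h <;> norm_num at h₁ <;> omega
  -- Sizes of the two chains.
  have two_branches {c d : ℕ} (hc1 : 1 ≤ c) (hc3 : c ≤ 3) (hd1 : 1 ≤ d) (hd3 : d ≤ 3)
      (hcd : c ≠ d) (i : ℤ)
      (h : ∀ v, v ∈ branch n c ∨ v ∈ branch n d → i ≤ I v ∧ I v < i + K) : False := by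
    have hdisj : Disjoint (branch n c) (branch n d) := by
      rw [Finset.disjoint_left]
      intro v hv hv'
      rw [mem_branch hc1 hc3] at hv
      rw [mem_branch hd1 hd3] at hv'
      omega
    have hcard : (branch n c ∪ branch n d).card ≤ (Finset.Ico i (i + K)).card := by
      apply Finset.card_le_card_of_injOn I
      · intro v hv
        simpa using h v (by simpa using hv)
      · intro u hu v hv e
        have lt {w : ℕ} (hw : w ∈ (↑(branch n c ∪ branch n d) : Set ℕ)) : w < 3 * n + 1 := by
          rcases Finset.mem_union.1 (Finset.mem_coe.1 hw) with hw | hw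
          · exact ((mem_branch hc1 hc3).1 hw).1
          · exact ((mem_branch hd1 hd3).1 hw).1
        exact hinj u (lt hu) v (lt hv) e
    rw [Finset.card_union_of_disjoint hdisj, card_branch, card_branch, Int.card_Ico] at hcard
    omega
  have chain_not_covered (c d : ℕ) (i : ℤ) (hi : -(K : ℤ) ≤ i) (hi' : i ≤ 1)
      (h : ∀ v < 3 * n + 1, i ≤ I v → I v < i + K → v ∈ branch n d ∨ v = c) : False := by
    have hsub : Finset.Ico i (i + K) ⊆ (insert c (branch n d)).image I := by
      intro j hj
      rw [Finset.mem_Ico] at hj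
      obtain ⟨v, hv, rfl⟩ := hsurj j (by omega) (by omega)
      refine Finset.mem_image_of_mem I ?_
      rw [Finset.mem_insert]
      exact (h v hv hj.1 hj.2).symm
    have h₁ := (Finset.card_le_card hsub).trans Finset.card_image_le
    have h₂ := Finset.card_insert_le c (branch n d)
    rw [Int.card_Ico] at h₁
    rw [card_branch] at h₂
    omega
  have pos_ne {u v : ℕ} (hu : u < 3 * n + 1) (hv : v < 3 * n + 1) (huv : u ≠ v) : I u ≠ I v :=
    fun e => huv (hinj u hu v hv e)
  -- Subtrees containing both extremes confine every disjoint subtree to one chain.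
  have confine {A B : ℕ → Prop} {ρ σ : ℕ} (hA : IsSubtree A ρ) (hB : IsSubtree B σ)
      (hAN : ∀ v, A v → v < 3 * n + 1) (hBN : ∀ v, B v → v < 3 * n + 1)
      (hAB : ∀ v, A v → ¬ B v) (hbA : A b) (htA : A t) :
      (∀ v, B v → -(K : ℤ) ≤ I v ∧ I v < -(K : ℤ) + K) ∨ (∀ v, B v → 1 ≤ I v ∧ I v < 1 + K) := by
    by_contra hcon
    push Not at hcon
    obtain ⟨⟨v, hv, hv'⟩, w, hw, hw'⟩ := hcon
    have h₁ := hrange v (hBN v hv)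
    have h₂ := hrange w (hBN w hw)
    have h₃ := pos_ne hbN (hBN v hv) (fun e => hAB b hbA (e ▸ hv))
    have h₄ := pos_ne hbN (hBN w hw) (fun e => hAB b hbA (e ▸ hw))
    have h₅ := pos_ne htN (hBN v hv) (fun e => hAB t htA (e ▸ hv))
    have h₆ := pos_ne htN (hBN w hw) (fun e => hAB t htA (e ▸ hw))
    have := hI.not_interleave hA hB hAN hBN hAB hbA htA hv hw
    unfold StrictBtw at this
    omega
  rcases hb07 with rfl | hb7
  · -- The root is lowest.
    obtain ⟨c, hc1, hc3, rfl⟩ : ∃ c, 1 ≤ c ∧ c ≤ 3 ∧ t = c + 3 :=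
      ⟨t - 3, by omega, by omega, by omega⟩
    have hside {d : ℕ} (hd1 : 1 ≤ d) (hd3 : d ≤ 3) (hcd : d ≠ c) :=
      confine (A := fun v => v = 0 ∨ v ∈ branch n c) (B := (· ∈ branch n d)) (ρ := 0) (σ := d)
        (by
          intro v hv hne
          simp only [mem_branch hc1 hc3] at hv ⊢
          omega)
        (isSubtree_branch hd1 hd3)
        (by
          intro v hv
          simp only [mem_branch hc1 hc3] at hv
          omega)
        (fun v hv => ((mem_branch hd1 hd3).1 hv).1)
        (by
          intro v hv
          simp only [mem_branch hc1 hc3, mem_branch hd1 hd3] at hv ⊢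
          omega)
        (Or.inl rfl) (by right; rw [mem_branch hc1 hc3]; omega)
    have hrest := confine (A := fun v => v = 0 ∨ v = c ∨ v = c + 3)
      (B := fun v => 7 ≤ v ∧ v ∈ branch n c) (ρ := 0) (σ := c + 6)
      (by intro v hv hne; omega)
      (by
        intro v hv hne
        simp only [mem_branch hc1 hc3] at hv ⊢
        omega)
      (by intro v hv; omega)
      (fun v hv => ((mem_branch hc1 hc3).1 hv.2).1)
      (by intro v hv; omega)
      (Or.inl rfl) (Or.inr (Or.inr rfl))
    -- Branches `d` and `e` occupy different chains, and the rest of branch `c` only one of them.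
    have finish {d e : ℕ} (hd1 : 1 ≤ d) (hd3 : d ≤ 3) (he1 : 1 ≤ e) (he3 : e ≤ 3) (hdc : d ≠ c)
        (hec : e ≠ c) (hde : d ≠ e) (i j : ℤ) (hi : -(K : ℤ) ≤ i) (hi1 : i ≤ 1)
        (h0 : ¬ (i ≤ 0 ∧ 0 < i + K)) (hij : ∀ x : ℤ, i ≤ x ∧ x < i + K → ¬ (j ≤ x ∧ x < j + K))
        (hd : ∀ v ∈ branch n d, i ≤ I v ∧ I v < i + K)
        (he : ∀ v ∈ branch n e, j ≤ I v ∧ I v < j + K)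
        (hW : ∀ v, 7 ≤ v ∧ v ∈ branch n c → j ≤ I v ∧ I v < j + K) : False := by
      refine chain_not_covered c d i hi hi1 fun v hv h₁ h₂ => ?_
      by_contra hcon
      push Not at hcon
      have hv0 : v ≠ 0 := by
        rintro rfl
        omega
      have hvt : v ≠ c + 3 := by
        rintro rfl
        omega
      have hve : v ∉ branch n e := fun h => hij _ ⟨h₁, h₂⟩ (he v h)
      have hvc : ¬ (7 ≤ v ∧ v ∈ branch n c) := fun h => hij _ ⟨h₁, h₂⟩ (hW v h)
      rw [mem_branch hc1 hc3] at hvc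
      rw [mem_branch he1 he3] at hve
      rw [mem_branch hd1 hd3] at hcon
      omega
    obtain ⟨d, e, hd1, hd3, he1, he3, hdc, hec, hde⟩ := exists_other_branches c
    rcases hside hd1 hd3 hdc with hd | hd <;> rcases hside he1 he3 hec with he | he
    · exact two_branches hd1 hd3 he1 he3 hde _ fun v hv => hv.elim (hd v) (he v)
    · rcases hrest with hW | hW
      · exact finish he1 he3 hd1 hd3 hec hdc hde.symm 1 (-K) (by omega) (by omega) (by omega)
          (by omega) he hd hW
      · exact finish hd1 hd3 he1 he3 hdc hec hde (-K) 1 (by omega) (by omega) (by omega)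
          (by omega) hd he hW
    · rcases hrest with hW | hW
      · exact finish hd1 hd3 he1 he3 hdc hec hde 1 (-K) (by omega) (by omega) (by omega)
          (by omega) hd he hW
      · exact finish he1 he3 hd1 hd3 hec hdc hde.symm (-K) 1 (by omega) (by omega) (by omega)
          (by omega) he hd hW
    · exact two_branches hd1 hd3 he1 he3 hde _ fun v hv => hv.elim (hd v) (he v)
  · -- The lowest vertex lies in the branch of `c`, below the head of the branch.
    obtain ⟨c, hc1, hc3, hbc⟩ : ∃ c, 1 ≤ c ∧ c ≤ 3 ∧ b ∈ branch n c := by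
      refine ⟨(b + 2) % 3 + 1, by omega, by omega, ?_⟩
      rw [mem_branch (by omega) (by omega)]
      omega
    have hbranch := isSubtree_branch (n := n) hc1 hc3
    have hbranchN (v : ℕ) (hv : v ∈ branch n c) : v < 3 * n + 1 := ((mem_branch hc1 hc3).1 hv).1
    have hcompl : IsSubtree (fun v => v < 3 * n + 1 ∧ v ∉ branch n c) 0 := by
      intro v hv hne
      simp only [mem_branch hc1 hc3] at hv ⊢
      omega
    have htc : t ∉ branch n c := by
      intro htc
      obtain ⟨d, e, hd1, hd3, he1, he3, hdc, hec, hde⟩ := exists_other_branches c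
      have hsub (v : ℕ) (hv : v ∈ branch n d ∨ v ∈ branch n e) :
          v < 3 * n + 1 ∧ v ∉ branch n c := by
        rw [mem_branch hd1 hd3, mem_branch he1 he3] at hv
        rw [mem_branch hc1 hc3]
        omega
      rcases confine hbranch hcompl hbranchN (fun v hv => hv.1) (fun v hv hv' => hv'.2 hv) hbc htc
        with h | h
      · exact two_branches hd1 hd3 he1 he3 hde _ fun v hv => h v (hsub v hv)
      · exact two_branches hd1 hd3 he1 he3 hde _ fun v hv => h v (hsub v hv)
    have hcc : c ∈ branch n c := by rw [mem_branch hc1 hc3]; omega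
    have h0c : 0 ∉ branch n c := by rw [mem_branch hc1 hc3]; omega
    have hsep₁ := hI.not_interleave hbranch hcompl hbranchN (fun v hv => hv.1)
      (fun v hv hv' => hv'.2 hv) hbc hcc ⟨by omega, h0c⟩ ⟨htN, htc⟩
    have hsep₂ := hI.not_interleave (A := fun v => v = 0 ∨ v = c)
      (B := fun v => c < v ∧ v ∈ branch n c) (ρ := 0) (σ := c + 3) (p := 0) (p' := c) (q := b)
      (q' := c + 3)
      (by intro v hv hne; omega)
      (by
        intro v hv hne
        simp only [mem_branch hc1 hc3] at hv ⊢
        omega)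
      (by intro v hv; omega)
      (fun v hv => hbranchN v hv.2)
      (by intro v hv; omega)
      (Or.inl rfl) (Or.inr rfl) ⟨by omega, hbc⟩ ⟨by omega, by rw [mem_branch hc1 hc3]; omega⟩
    have h₁ := hup c (by omega) hc1 (by omega)
    have h₂ := hup (c + 3) (by omega) (by omega) (by omega)
    rw [show c - 3 = 0 by omega] at h₁
    rw [show c + 3 - 3 = c by omega] at h₂
    have r₀ := hrange 0 (by omega)
    have r₁ := hrange c (by omega)
    have r₂ := hrange (c + 3) (by omega)
    have n₀ := pos_ne hbN (v := 0) (by omega) (by omega)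
    have n₁ := pos_ne hbN (v := c) (by omega) (by omega)
    have n₂ := pos_ne htN (v := 0) (by omega) (by omega)
    have n₃ := pos_ne htN (v := c) (by omega) (by omega)
    unfold StrictBtw at hsep₁ hsep₂
    rcases abs_cases (4 * I 0 + 1) with a₀ | a₀ <;> rcases abs_cases (4 * I c + 1) with a₁ | a₁ <;>
      rcases abs_cases (4 * I (c + 3) + 1) with a₂ | a₂ <;> omega

/-! ### The tree -/

/-- The spider with three legs, vertex `v ≥ 1` being joined to `v - 3`; the first two edges of
each leg point away from the centre `0`, all others towards it. -/
def spiderAdj (N : ℕ) (u v : Fin N) : Prop :=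
  (1 ≤ v.val ∧ v.val ≤ 6 ∧ u.val = v.val - 3) ∨ (7 ≤ u.val ∧ v.val = u.val - 3)

lemma fromRel_spiderAdj_adj {N : ℕ} {u v : Fin N} :
    (SimpleGraph.fromRel (spiderAdj N)).Adj u v ↔
      (1 ≤ v.val ∧ u.val = v.val - 3) ∨ (1 ≤ u.val ∧ v.val = u.val - 3) := by
  rw [SimpleGraph.fromRel_adj, ne_eq, Fin.ext_iff]
  unfold spiderAdj
  omega

lemma isTree_fromRel_spiderAdj (M : ℕ) : (SimpleGraph.fromRel (spiderAdj (M + 1))).IsTree := by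
  set G := SimpleGraph.fromRel (spiderAdj (M + 1)) with hG
  have hreach (m : ℕ) (hm : m < M + 1) : G.Reachable ⟨m, hm⟩ 0 := by
    induction m using Nat.strong_induction_on with
    | _ m ih =>
      rcases Nat.eq_zero_or_pos m with rfl | h
      · exact SimpleGraph.Reachable.refl _
      · refine SimpleGraph.Reachable.trans (SimpleGraph.Adj.reachable ?_)
          (ih (m - 3) (by omega) (by omega))
        rw [hG, fromRel_spiderAdj_adj]
        right
        exact ⟨h, rfl⟩
  rw [SimpleGraph.isTree_iff_connected_and_card]
  refine ⟨⟨fun u v => (hreach u u.2).trans (hreach v v.2).symm⟩, ?_⟩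
  let e (i : Fin M) : Sym2 (Fin (M + 1)) := s(i.succ, ⟨i.val + 1 - 3, by omega⟩)
  have he : Function.Injective e := by
    intro i j h
    simp only [e, Sym2.eq_iff, Fin.ext_iff, Fin.val_succ] at h
    ext
    omega
  have hedge : G.edgeSet = Set.range e := by
    ext s
    induction s using Sym2.ind with
    | _ u v =>
      rw [SimpleGraph.mem_edgeSet, hG, fromRel_spiderAdj_adj]
      simp only [e, Set.mem_range, Sym2.eq_iff, Fin.ext_iff, Fin.val_succ]
      constructor
      · rintro (⟨h, h'⟩ | ⟨h, h'⟩)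
        · exact ⟨⟨v.val - 1, by omega⟩, by simp only; omega⟩
        · exact ⟨⟨u.val - 1, by omega⟩, by simp only; omega⟩
      · rintro ⟨i, hi⟩
        omega
  rw [hedge, Nat.card_range_of_injective he]
  simp

lemma isDirTree_spiderAdj (M : ℕ) : IsDirTree (spiderAdj (M + 1)) := by
  refine ⟨fun u v => ?_, fun v => ?_, isTree_fromRel_spiderAdj M⟩
  · unfold spiderAdj
    omega
  · unfold spiderAdj
    omega

/-- An embedding of the spider into grid points yields a noncrossing placement. -/
lemma UPSE.placement {N : ℕ} {S : Finset (ℝ × ℝ)} {f : Fin N → ℝ × ℝ}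
    (hf : UPSE (spiderAdj N) S f) {I : ℕ → ℤ} (hI : ∀ v (h : v < N), f ⟨v, h⟩ = gridPoint (I v)) :
    Placement N I := by
  obtain ⟨hinj, -, -, hcross⟩ := hf
  have inj (u : ℕ) (hu : u < N) (v : ℕ) (hv : v < N) (h : I u = I v) : u = v := by
    have : f ⟨u, hu⟩ = f ⟨v, hv⟩ := by rw [hI, hI, h]
    simpa using hinj this
  have edge (u : ℕ) (hu : u < N) (h1 : 1 ≤ u) : ∃ a b : Fin N, spiderAdj N a b ∧
      segment ℝ (f a) (f b) = segment ℝ (gridPoint (I u)) (gridPoint (I (u - 3))) ∧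
      ((a.val = u ∧ b.val = u - 3) ∨ (b.val = u ∧ a.val = u - 3)) := by
    by_cases h6 : u ≤ 6
    · refine ⟨⟨u - 3, by omega⟩, ⟨u, hu⟩, Or.inl ⟨h1, h6, rfl⟩, ?_, Or.inr ⟨rfl, rfl⟩⟩
      rw [hI, hI, segment_symm]
    · refine ⟨⟨u, hu⟩, ⟨u - 3, by omega⟩, Or.inr ⟨by simp only; omega, rfl⟩, ?_, Or.inl ⟨rfl, rfl⟩⟩
      rw [hI, hI]
  refine ⟨inj, fun u hu v hv hu1 hv1 h₁ h₂ h₃ h₄ => ?_⟩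
  obtain ⟨a, b, hab, hsab, hab'⟩ := edge u hu hu1
  obtain ⟨c, d, hcd, hscd, hcd'⟩ := edge v hv hv1
  have disj (p : ℝ × ℝ) (hp : p ∈ segment ℝ (gridPoint (I u)) (gridPoint (I (u - 3))))
      (hp' : p ∈ segment ℝ (gridPoint (I v)) (gridPoint (I (v - 3)))) : False := by
    obtain ⟨h, h'⟩ := hcross a b c d hab hcd
      (by simp only [ne_eq, Prod.mk.injEq, Fin.ext_iff]; omega) p (hsab ▸ hp) (hscd ▸ hp')
    simp only [Set.mem_insert_iff, Set.mem_singleton_iff] at h h'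
    rcases h with rfl | rfl <;> rcases h' with h' | h' <;>
      · have := Fin.ext_iff.1 (hinj h')
        omega
  have ne₁ : I v ≠ I u := fun h => h₁ (inj v hv u hu h).symm
  have ne₂ : I v ≠ I (u - 3) := fun h => h₄ (inj v hv (u - 3) (by omega) h)
  have ne₃ : I (v - 3) ≠ I u := fun h => h₃ (inj (v - 3) (by omega) u hu h).symm
  have ne₄ : I (v - 3) ≠ I (u - 3) := fun h => h₂ (inj (v - 3) (by omega) (u - 3) (by omega) h).symm
  constructor
  · intro h
    by_contra h'
    obtain ⟨p, hp, hp'⟩ := exists_mem_segment_of_strictBtw h h' ne₃ ne₄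
    exact disj p hp hp'
  · intro h
    by_contra h'
    obtain ⟨p, hp, hp'⟩ := exists_mem_segment_of_strictBtw h h' ne₁ ne₂
    exact disj p hp (by rwa [segment_symm])

theorem exists_tree_no_UPSE (n : ℕ) (hn : 5 ≤ n) (hodd : Odd n) :
    ∃ (Adj : Fin (3 * n + 1) → Fin (3 * n + 1) → Prop) (S : Finset (ℝ × ℝ)),
      IsDirTree Adj ∧ ConvexPos S ∧ S.card = 3 * n + 1 ∧
      ¬ ∃ f : Fin (3 * n + 1) → ℝ × ℝ, UPSE Adj S f := by
  obtain ⟨K, hK⟩ : ∃ K : ℕ, 2 * K + 2 = 3 * n + 1 := by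
    obtain ⟨k, rfl⟩ := hodd
    exact ⟨3 * k + 1, by omega⟩
  have hcard : ((Finset.Icc (-(K : ℤ)) (K + 1)).map gridPoint).card = 3 * n + 1 := by
    rw [Finset.card_map, Int.card_Icc]
    omega
  refine ⟨spiderAdj (3 * n + 1), (Finset.Icc (-(K : ℤ)) (K + 1)).map gridPoint,
    isDirTree_spiderAdj _, convexPos_map_gridPoint _, hcard, ?_⟩
  rintro ⟨f, hf⟩
  obtain ⟨hinj, hmem, hup, -⟩ := id hf
  have hex (v : Fin (3 * n + 1)) : ∃ i : ℤ, (-(K : ℤ) ≤ i ∧ i ≤ K + 1) ∧ gridPoint i = f v := by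
    simpa using hmem v
  choose J hJ hJf using hex
  have hI (v : ℕ) (h : v < 3 * n + 1) :
      f ⟨v, h⟩ = gridPoint (if h : v < 3 * n + 1 then J ⟨v, h⟩ else 0) := by
    rw [dif_pos h, hJf]
  refine (hf.placement hI).false_of_upward hn hK ?_ ?_ ?_ ?_
  · intro v hv
    rw [dif_pos hv]
    exact hJ _
  · intro i h₁ h₂
    obtain ⟨v, -, hv⟩ := Finset.surj_on_of_inj_on_of_card_le
      (s := Finset.univ) (t := (Finset.Icc (-(K : ℤ)) (K + 1)).map gridPoint)
      (fun v _ => f v) (fun v _ => hmem v) (fun u v _ _ h => hinj h)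
      (by rw [hcard, Finset.card_univ, Fintype.card_fin]) (gridPoint i)
      (Finset.mem_map_of_mem _ (Finset.mem_Icc.2 ⟨h₁, h₂⟩))
    refine ⟨v, v.2, ?_⟩
    rw [dif_pos v.2]
    exact gridPoint.injective ((hJf v).trans hv.symm)
  · intro v hv h1 h6
    rw [← gridPoint_snd_lt_iff, ← hI v hv, ← hI (v - 3) (by omega)]
    exact hup _ _ (Or.inl ⟨h1, h6, rfl⟩)
  · intro v hv h7
    rw [← gridPoint_snd_lt_iff, ← hI v hv, ← hI (v - 3) (by omega)]
    exact hup _ _ (Or.inr ⟨h7, rfl⟩)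
end
end
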